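/- arXiv:2504.04496 — 2 statements merged into one kernel-verified Lean document; each statement's English description precedes it below -/
import Mathlib

section
/- Let G be a (fork, odd parachute)-free graph. If G is not perfectly divisible, then G contains a trisimplicial vertex, i.e., a vertex whose neighborhood is the union of three cliques. -/
open SimpleGraph

/-- The clique number ω(G). -/
noncomputable def cliqueNumber {V : Type*} (G : SimpleGraph V) : ℕ :=
  sSup {n | ∃ s : Finset V, G.IsNClique n s}

/-- A graph is perfect if every induced subgraph has chromatic number equal to clique number. -/
def IsPerfectGraph {V : Type*} (G : SimpleGraph V) : Prop :=
  ∀ S : Set V, (G.induce S).chromaticNumber = (cliqueNumber (G.induce S) : ℕ∞)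

/-- A graph is perfectly divisible if each (nonempty) induced subgraph H has a partition of its
vertices into A and B with H[A] perfect and ω(H[B]) < ω(H). -/
def PerfectlyDivisible {V : Type*} (G : SimpleGraph V) : Prop :=
  ∀ S : Set V, S.Nonempty →
    ∃ A B : Set V, A ∪ B = S ∧ A ∩ B = ∅ ∧
      IsPerfectGraph (G.induce A) ∧
      cliqueNumber (G.induce B) < cliqueNumber (G.induce S)

/-- A vertex is trisimplicial if its neighborhood is the union of three cliques. -/
def Trisimplicial {V : Type*} (G : SimpleGraph V) (u : V) : Prop :=
  ∃ C₁ C₂ C₃ : Set V, G.IsClique C₁ ∧ G.IsClique C₂ ∧ G.IsClique C₃ ∧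
    G.neighborSet u = C₁ ∪ C₂ ∪ C₃

/-- The claw K₁,₃ : vertex 0 is the center, adjacent to 1, 2, 3. -/
def claw : SimpleGraph (Fin 4) :=
  SimpleGraph.fromRel (fun a _ => a = 0)

/-- The fork (chair): claw with one edge subdivided once.
Vertex 2 is the center, adjacent to 0, 1, 3; and 3 is adjacent to 4. -/
def fork : SimpleGraph (Fin 5) :=
  SimpleGraph.fromRel (fun a b => (a = 2 ∧ (b = 0 ∨ b = 1 ∨ b = 3)) ∨ (a = 3 ∧ b = 4))

/-- The odd parachute on hole length n: hole vertices `Sum.inl i` (i : ZMod n),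
`Sum.inr 0` is complete to the hole, `Sum.inr 1` is adjacent only to `Sum.inr 0`. -/
def oddParachute (n : ℕ) : SimpleGraph (ZMod n ⊕ Fin 2) :=
  SimpleGraph.fromRel (fun a b =>
    (∃ i : ZMod n, a = Sum.inl i ∧ b = Sum.inl (i + 1)) ∨
    (∃ i : ZMod n, a = Sum.inl i ∧ b = Sum.inr 0) ∨
    (a = Sum.inr 0 ∧ b = Sum.inr 1))

/-- The odd balloon on hole length n: hole vertices `Sum.inl i`, the center `Sum.inr 0`
adjacent to the consecutive hole vertices `Sum.inl 0`, `Sum.inl 1` and to the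
pendant vertex `Sum.inr 1`. -/
def oddBalloon (n : ℕ) : SimpleGraph (ZMod n ⊕ Fin 2) :=
  SimpleGraph.fromRel (fun a b =>
    (∃ i : ZMod n, a = Sum.inl i ∧ b = Sum.inl (i + 1)) ∨
    (a = Sum.inr 0 ∧ (b = Sum.inl 0 ∨ b = Sum.inl 1 ∨ b = Sum.inr 1)))

/-- G has no induced fork. -/
def ForkFree {V : Type*} (G : SimpleGraph V) : Prop := IsEmpty (fork ↪g G)

/-- G has no induced claw. -/
def ClawFree {V : Type*} (G : SimpleGraph V) : Prop := IsEmpty (claw ↪g G)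

/-- G has no induced odd parachute. -/
def OddParachuteFree {V : Type*} (G : SimpleGraph V) : Prop :=
  ∀ n : ℕ, 5 ≤ n → Odd n → IsEmpty (oddParachute n ↪g G)

/-- `v : ZMod n → V` enumerates an induced cycle of `G`:
`v` is injective and `v i ~ v j` iff `i, j` are consecutive mod `n`. -/
def IsInducedCycle {V : Type*} (G : SimpleGraph V) {n : ℕ} (v : ZMod n → V) : Prop :=
  Function.Injective v ∧ ∀ i j : ZMod n, G.Adj (v i) (v j) ↔ (j = i + 1 ∨ i = j + 1)

namespace ForkParachute

open scoped Classical

variable {V : Type*} {G : SimpleGraph V}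

/-- The largest size of a clique contained in `S`. -/
noncomputable def om (G : SimpleGraph V) (S : Finset V) : ℕ :=
  (S.powerset.filter fun Q : Finset V => G.IsClique (Q : Set V)).sup Finset.card

/-- `S` has a proper colouring with `k` colours. -/
def Col (G : SimpleGraph V) (S : Finset V) (k : ℕ) : Prop :=
  ∃ f : V → ℕ, (∀ x ∈ S, f x < k) ∧ ∀ x ∈ S, ∀ y ∈ S, G.Adj x y → f x ≠ f y

/-- The subgraph induced by `S` is perfect. -/
def Perf (G : SimpleGraph V) (S : Finset V) : Prop :=
  ∀ T ⊆ S, Col G T (om G T)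

/-- The subgraph induced by `T` is minimally imperfect. -/
def MinImp (G : SimpleGraph V) (T : Finset V) : Prop :=
  ¬ Col G T (om G T) ∧ ∀ S ⊂ T, Col G S (om G S)

/-- `S` is a stable set. -/
def Stab (G : SimpleGraph V) (S : Finset V) : Prop :=
  ∀ x ∈ S, ∀ y ∈ S, ¬ G.Adj x y

theorem le_om {S Q : Finset V} (hQ : Q ⊆ S) (h : G.IsClique (Q : Set V)) :
    Q.card ≤ om G S := by
  apply Finset.le_sup (f := Finset.card)
  simp [hQ, h]

theorem exists_om (G : SimpleGraph V) (S : Finset V) :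
    ∃ Q ⊆ S, G.IsClique (Q : Set V) ∧ Q.card = om G S := by
  have hne : (S.powerset.filter fun Q : Finset V => G.IsClique (Q : Set V)).Nonempty :=
    ⟨∅, by simp⟩
  obtain ⟨Q, hQ, h⟩ := Finset.exists_mem_eq_sup _ hne Finset.card
  simp only [Finset.mem_filter, Finset.mem_powerset] at hQ
  refine ⟨Q, hQ.1, hQ.2, ?_⟩
  rw [← h, om]

theorem om_mono {S T : Finset V} (h : S ⊆ T) : om G S ≤ om G T := by
  obtain ⟨Q, hQ, hc, hk⟩ := exists_om G S
  exact hk ▸ le_om (hQ.trans h) hc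

theorem om_pos {S : Finset V} {x : V} (h : x ∈ S) : 1 ≤ om G S := by
  have := le_om (G := G) (S := S) (Q := {x}) (by simpa using h) (by simp)
  simpa using this

theorem Col.mono {S T : Finset V} {k l : ℕ} (h : Col G T k) (hS : S ⊆ T) (hk : k ≤ l) :
    Col G S l := by
  obtain ⟨f, h1, h2⟩ := h
  exact ⟨f, fun x hx => (h1 x (hS hx)).trans_le hk, fun x hx y hy => h2 x (hS hx) y (hS hy)⟩

/-- A clique meets each colour class at most once. -/
theorem card_le_of_colouring {Q : Finset V} {f : V → ℕ} {C : Finset ℕ}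
    (hc : G.IsClique (Q : Set V)) (hf : ∀ x ∈ Q, ∀ y ∈ Q, G.Adj x y → f x ≠ f y)
    (hC : ∀ x ∈ Q, f x ∈ C) : Q.card ≤ C.card := by
  apply Finset.card_le_card_of_injOn f hC
  intro x hx y hy hxy
  by_contra hne
  exact hf x hx y hy (hc hx hy hne) hxy

theorem Perf.mono {S T : Finset V} (h : Perf G T) (hS : S ⊆ T) : Perf G S :=
  fun U hU => h U (hU.trans hS)

theorem exists_minImp {S : Finset V} (h : ¬ Perf G S) : ∃ T ⊆ S, MinImp G T := by
  induction S using Finset.strongInduction with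
  | H S ih =>
    by_cases hS : ∀ R ⊂ S, Perf G R
    · refine ⟨S, subset_rfl, fun hc => h fun T hT => ?_, fun R hR => hS R hR R subset_rfl⟩
      rcases hT.eq_or_ssubset with rfl | hT
      · exact hc
      · exact hS T hT T subset_rfl
    · push Not at hS
      obtain ⟨R, hR, hp⟩ := hS
      obtain ⟨T, hT, hm⟩ := ih R hR hp
      exact ⟨T, hT.trans hR.subset, hm⟩

theorem Perf.not_minImp {S T : Finset V} (h : Perf G S) (hT : T ⊆ S) : ¬ MinImp G T :=
  fun hm => hm.1 (h T hT)

theorem Col.union {A B : Finset V} {a b : ℕ} (hA : Col G A a) (hB : Col G B b) :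
    Col G (A ∪ B) (a + b) := by
  obtain ⟨f, f1, f2⟩ := hA
  obtain ⟨g, g1, g2⟩ := hB
  refine ⟨fun x => if x ∈ A then f x else a + g x, ?_, ?_⟩
  · intro x hx
    have := f1 x
    have := g1 x
    simp only [Finset.mem_union] at hx
    dsimp only
    split_ifs with h
    · have := f1 x h
      omega
    · have := g1 x (by tauto)
      omega
  · intro x hx y hy hxy
    simp only [Finset.mem_union] at hx hy
    have := f1 x
    have := f1 y
    have := f2 x
    have := g2 x
    dsimp only
    split_ifs with h h' h'
    · exact f2 x h y h' hxy
    · have := f1 x h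
      omega
    · have := f1 y h'
      omega
    · have := g2 x (by tauto) y (by tauto) hxy
      omega

theorem col_one_of_stab {S : Finset V} (h : Stab G S) : Col G S 1 :=
  ⟨fun _ => 0, by simp, fun x hx y hy hxy => (h x hx y hy hxy).elim⟩

namespace MinImp

variable {T : Finset V}

/-- Deleting a nonempty stable set from a minimally imperfect graph keeps the clique number. -/
theorem exists_clique (h : MinImp G T) {S : Finset V} (hS : S ⊆ T) (hs : Stab G S)
    (hne : S.Nonempty) : ∃ Q ⊆ T \ S, G.IsClique (Q : Set V) ∧ Q.card = om G T := by
  obtain ⟨Q, hQ, hc, hk⟩ := exists_om G (T \ S)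
  obtain ⟨s, hsS⟩ := hne
  refine ⟨Q, hQ, hc, le_antisymm (hk ▸ om_mono Finset.sdiff_subset) ?_⟩
  by_contra! hlt
  have h1 : Col G (T \ S) (om G (T \ S)) := by
    refine h.2 _ (Finset.ssubset_iff_subset_ne.2 ⟨Finset.sdiff_subset, fun he => ?_⟩)
    have := hS hsS
    rw [← he] at this
    simp [hsS] at this
  refine h.1 ((h1.union (col_one_of_stab hs)).mono ?_ (by omega))
  intro x hx
  simp [hx]

theorem colouring_erase (h : MinImp G T) {S : Finset V} (hS : S ⊂ T) : Col G S (om G T) :=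
  (h.2 S hS).mono subset_rfl (om_mono hS.subset)

/-- A minimally imperfect graph has no star cutset. -/
theorem no_star_cutset (h : MinImp G T) {c : V} {A B : Finset V} (hc : c ∈ T) (hA : A ⊆ T)
    (hB : B ⊆ T) (hAne : A.Nonempty) (hBne : B.Nonempty) (hcA : c ∉ A) (hcB : c ∉ B)
    (hd : ∀ a ∈ A, a ∉ B) (hAB : ∀ a ∈ A, ∀ b ∈ B, ¬ G.Adj a b)
    (hT : ∀ x ∈ T, x = c ∨ G.Adj c x ∨ x ∈ A ∨ x ∈ B) : False := by
  obtain ⟨a, ha⟩ := hAne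
  obtain ⟨b, hb⟩ := hBne
  have hss : ∀ {U : Finset V} {u : V}, U ⊆ T → u ∈ U → T \ U ⊂ T := fun hU hu =>
    Finset.sdiff_ssubset hU ⟨_, hu⟩
  obtain ⟨f, f1, f2⟩ := h.colouring_erase (hss hB hb)
  obtain ⟨g, g1, g2⟩ := h.colouring_erase (hss hA ha)
  set S := T.filter fun x => (x ∉ B ∧ f x = f c) ∨ (x ∉ A ∧ g x = g c) with hS
  have hfA : ∀ x ∈ T, x ∉ B → f x = f c → x = c ∨ x ∈ A := by
    intro x hx hxB hfx
    rcases hT x hx with h1 | h1 | h1 | h1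
    · exact .inl h1
    · exact (f2 c (by simp [*]) x (by simp [*]) h1 hfx.symm).elim
    · exact .inr h1
    · exact (hxB h1).elim
  have hgB : ∀ x ∈ T, x ∉ A → g x = g c → x = c ∨ x ∈ B := by
    intro x hx hxB hfx
    rcases hT x hx with h1 | h1 | h1 | h1
    · exact .inl h1
    · exact (g2 c (by simp [*]) x (by simp [*]) h1 hfx.symm).elim
    · exact (hxB h1).elim
    · exact .inr h1
  have hst : Stab G S := by
    intro x hx y hy hxy
    simp only [hS, Finset.mem_filter] at hx hy
    rcases hx with ⟨hx, hx1 | hx1⟩ <;> rcases hy with ⟨hy, hy1 | hy1⟩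
    · exact f2 x (by simp [*]) y (by simp [*]) hxy (hx1.2.trans hy1.2.symm)
    · rcases hfA x hx hx1.1 hx1.2 with rfl | hxA
      · exact g2 x (by simp [*]) y (by simp [*]) hxy hy1.2.symm
      · rcases hgB y hy hy1.1 hy1.2 with rfl | hyB
        · exact f2 x (by simp [*]) y (by simp [*]) hxy hx1.2
        · exact hAB x hxA y hyB hxy
    · rcases hfA y hy hy1.1 hy1.2 with rfl | hxA
      · exact g2 x (by simp [*]) y (by simp [*]) hxy hx1.2
      · rcases hgB x hx hx1.1 hx1.2 with rfl | hyB
        · exact f2 x (by simp [*]) y (by simp [*]) hxy hy1.2.symm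
        · exact hAB y hxA x hyB hxy.symm
    · exact g2 x (by simp [*]) y (by simp [*]) hxy (hx1.2.trans hy1.2.symm)
  obtain ⟨Q, hQ, hQc, hk⟩ := h.exists_clique (S := S) (Finset.filter_subset _ _) hst
    ⟨c, by simp [hS, hc, hcB]⟩
  have hQ' : ∀ x ∈ Q, x ∈ T ∧ x ∉ S := fun x hx => by simpa using hQ hx
  have key : ∀ (k : V → ℕ), (∀ x ∈ Q, k x < om G T) → (∀ x ∈ Q, k x ≠ k c) → k c < om G T →
      (∀ x ∈ Q, ∀ y ∈ Q, G.Adj x y → k x ≠ k y) → False := by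
    intro k k1 k2 k3 k4
    have := card_le_of_colouring (C := (Finset.range (om G T)).erase (k c)) hQc k4
      (fun x hx => by simp [k1 x hx, k2 x hx])
    rw [Finset.card_erase_of_mem (by simpa using k3), Finset.card_range] at this
    omega
  by_cases hQA : ∃ x ∈ Q, x ∈ A
  · obtain ⟨x, hx, hxA⟩ := hQA
    have hQB : ∀ y ∈ Q, y ∉ B := fun y hy hyB => by
      have hne : x ≠ y := fun he => hd x hxA (he ▸ hyB)
      exact hAB x hxA y hyB (hQc hx hy hne)
    refine key f (fun y hy => f1 y (by simp [hQ' y hy, hQB y hy])) (fun y hy he => ?_)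
      (f1 c (by simp [*])) (fun y hy z hz => f2 y (by simp [hQ' y hy, hQB y hy]) z
        (by simp [hQ' z hz, hQB z hz]))
    exact (hQ' y hy).2 (by simp [hS, (hQ' y hy).1, hQB y hy, he])
  · push Not at hQA
    refine key g (fun y hy => g1 y (by simp [hQ' y hy, hQA y hy])) (fun y hy he => ?_)
      (g1 c (by simp [*])) (fun y hy z hz => g2 y (by simp [hQ' y hy, hQA y hy]) z
        (by simp [hQ' z hz, hQA z hz]))
    exact (hQ' y hy).2 (by simp [hS, (hQ' y hy).1, hQA y hy, he])

/-- A minimally imperfect graph is not a join. -/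
theorem not_join (h : MinImp G T) {A : Finset V} (hA : A ⊂ T) (hne : A.Nonempty)
    (hAB : ∀ a ∈ A, ∀ b ∈ T, b ∉ A → G.Adj a b) : False := by
  obtain ⟨P, hP, hPc, hPk⟩ := exists_om G A
  obtain ⟨Q, hQ, hQc, hQk⟩ := exists_om G (T \ A)
  have hQ' : ∀ x ∈ Q, x ∈ T ∧ x ∉ A := fun x hx => by simpa using hQ hx
  have hle : om G A + om G (T \ A) ≤ om G T := by
    rw [← hPk, ← hQk, ← Finset.card_union_of_disjoint]
    · apply le_om
      · exact Finset.union_subset (hP.trans hA.subset) (hQ.trans Finset.sdiff_subset)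
      · intro x hx y hy hxy
        simp only [Finset.coe_union, Set.mem_union, Finset.mem_coe] at hx hy
        rcases hx with hx | hx <;> rcases hy with hy | hy
        · exact hPc hx hy hxy
        · exact hAB x (hP hx) y (hQ' y hy).1 (hQ' y hy).2
        · exact (hAB y (hP hy) x (hQ' x hx).1 (hQ' x hx).2).symm
        · exact hQc hx hy hxy
    · rw [Finset.disjoint_left]
      exact fun x hx hx' => (hQ' x hx').2 (hP hx)
  refine h.1 (((h.2 A hA).union (h.2 (T \ A) (Finset.sdiff_ssubset hA.subset hne))).mono ?_ hle)
  intro x hx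
  simp [hx]

/-- A minimally imperfect graph has no isolated vertex. -/
theorem exists_adj (h : MinImp G T) {v : V} (hv : v ∈ T) : ∃ x ∈ T, G.Adj v x := by
  by_contra! hno
  obtain ⟨f, f1, f2⟩ := h.colouring_erase (Finset.erase_ssubset hv)
  refine h.1 ⟨fun x => if x = v then 0 else f x, fun x hx => ?_, fun x hx y hy hxy => ?_⟩
  · have := om_pos (G := G) hv
    dsimp only
    split_ifs with he
    · omega
    · exact f1 x (by simp [*])
  · have hx' : x ≠ v := by rintro rfl; exact hno y hy hxy
    have hy' : y ≠ v := by rintro rfl; exact hno x hx hxy.symm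
    simpa [hx', hy'] using f2 x (by simp [*]) y (by simp [*]) hxy

/-- A minimally imperfect graph has no nontrivial homogeneous set. -/
theorem not_homogeneous (h : MinImp G T) {K : Finset V} (hK : K ⊂ T) (h2 : 2 ≤ K.card)
    (hom : ∀ z ∈ T, z ∉ K → (∀ k ∈ K, G.Adj z k) ∨ ∀ k ∈ K, ¬ G.Adj z k) : False := by
  obtain ⟨c, hc, d, hd, hcd⟩ := Finset.one_lt_card.1 h2
  by_cases hO : ∃ z ∈ T, z ∉ K ∧ ¬ G.Adj z c
  · obtain ⟨o, hoT, hoK, ho⟩ := hO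
    refine h.no_star_cutset (c := c) (A := K.erase c)
      (B := T.filter fun z => z ∉ K ∧ ¬ G.Adj z c) (hK.subset hc)
      ((Finset.erase_subset _ _).trans hK.subset) (Finset.filter_subset _ _)
      ⟨d, by simp [hd, hcd.symm]⟩ ⟨o, by simp [*]⟩ (by simp) (by simp [hc]) ?_ ?_ ?_
    · intro a ha
      simp only [Finset.mem_erase] at ha
      simp [ha.2]
    · intro a ha b hb hab
      simp only [Finset.mem_erase, Finset.mem_filter] at ha hb
      rcases hom b hb.1 hb.2.1 with h1 | h1
      · exact hb.2.2 (h1 c hc)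
      · exact h1 a ha.2 hab.symm
    · intro x hx
      by_cases hxc : x = c
      · exact .inl hxc
      · by_cases hxK : x ∈ K
        · simp [hxc, hxK]
        · have := G.adj_comm c x
          simp [hx, hxK, hxc]
          tauto
  · push Not at hO
    refine h.not_join hK ⟨c, hc⟩ fun a ha b hb hbK => ?_
    rcases hom b hb hbK with h1 | h1
    · exact (h1 a ha).symm
    · exact (h1 c hc (hO b hb hbK)).elim

/-- No vertex of a minimally imperfect graph is dominated by one of its neighbours. -/
theorem not_dominated (h : MinImp G T) {x y : V} (hx : x ∈ T) (hy : y ∈ T) (hxy : G.Adj x y)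
    (hdom : ∀ z ∈ T, G.Adj z x → z = y ∨ G.Adj z y) : False := by
  by_cases hB : ∃ z ∈ T, z ≠ y ∧ ¬ G.Adj z y
  · obtain ⟨o, hoT, hoK, ho⟩ := hB
    refine h.no_star_cutset (c := y) (A := {x})
      (B := T.filter fun z => z ≠ y ∧ ¬ G.Adj z y) hy (by simpa using hx)
      (Finset.filter_subset _ _) (by simp) ⟨o, by simp [*]⟩ (by simpa using hxy.ne.symm)
      (by simp) (by simp [hxy]) ?_ ?_
    · intro a ha b hb hab
      simp only [Finset.mem_singleton, Finset.mem_filter] at ha hb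
      subst ha
      have := hdom b hb.1 hab.symm
      tauto
    · intro z hz
      have := G.adj_comm y z
      simp [hz]
      tauto
  · push Not at hB
    refine h.not_join (A := {y}) ?_ (by simp) ?_
    · refine Finset.ssubset_iff_subset_ne.2 ⟨by simpa using hy, ?_⟩
      rintro rfl
      simp only [Finset.mem_singleton] at hx
      exact hxy.ne hx
    · intro a ha b hb hba
      simp only [Finset.mem_singleton] at ha hba
      subst ha
      exact (hB b hb hba).symm

end MinImp

open Matrix in
theorem linearIndependent_of_dotProduct {ι κ : Type*} [Fintype ι] [DecidableEq ι] [Fintype κ]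
    {a b : ι → κ → ℚ} (h : ∀ i j, a i ⬝ᵥ b j = if i = j then 0 else 1)
    (hc : Fintype.card ι ≠ 1) : LinearIndependent ℚ a := by
  rw [Fintype.linearIndependent_iff]
  intro c hsum
  have key : ∀ j, ∑ i, c i = c j := by
    intro j
    have h1 : (∑ i, c i • a i) ⬝ᵥ b j = 0 := by rw [hsum, zero_dotProduct]
    rw [sum_dotProduct] at h1
    simp only [smul_dotProduct, h, smul_eq_mul, mul_ite, mul_zero, mul_one] at h1
    have h2 : ∑ i, c i = (∑ i, if i = j then 0 else c i) + ∑ i, if i = j then c i else 0 := by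
      rw [← Finset.sum_add_distrib]
      refine Finset.sum_congr rfl fun i _ => ?_
      split_ifs <;> simp
    rw [h2, h1]
    simp
  have hs : (∑ i, c i) * (Fintype.card ι - 1) = 0 := by
    have h3 : ∑ j, (∑ i, c i) = ∑ j, c j := Finset.sum_congr rfl fun j _ => key j
    rw [Finset.sum_const, Finset.card_univ, nsmul_eq_mul] at h3
    linear_combination h3
  have hne : (Fintype.card ι : ℚ) - 1 ≠ 0 := by
    rw [sub_ne_zero]
    exact_mod_cast hc
  have h0 : ∑ i, c i = 0 := by
    rcases mul_eq_zero.1 hs with h | h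
    · exact h
    · exact (hne h).elim
  exact fun i => (key i).symm.trans h0

open Matrix in
theorem eq_zero_of_dotProduct_eq_zero {ι κ : Type*} [Fintype ι] [Fintype κ]
    {a : ι → κ → ℚ} (ha : LinearIndependent ℚ a) (hc : Fintype.card ι = Fintype.card κ)
    {v : κ → ℚ} (hv : ∀ i, a i ⬝ᵥ v = 0) : v = 0 := by
  have hspan : Submodule.span ℚ (Set.range a) = ⊤ := by
    apply ha.span_eq_top_of_card_eq_finrank'
    simpa using hc
  have hmem : v ∈ Submodule.span ℚ (Set.range a) := by rw [hspan]; trivial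
  have : ∀ w ∈ Submodule.span ℚ (Set.range a), w ⬝ᵥ v = 0 := by
    intro w hw
    induction hw using Submodule.span_induction with
    | mem x hx => obtain ⟨i, rfl⟩ := hx; exact hv i
    | zero => simp
    | add x y _ _ h1 h2 => rw [add_dotProduct, h1, h2, add_zero]
    | smul r x _ h1 => rw [smul_dotProduct, h1, smul_zero]
  exact dotProduct_self_eq_zero.1 (this v hmem)

/-- `S` is a stable subset of `T` of maximum size. -/
def IsMaxStab (G : SimpleGraph V) (T S : Finset V) : Prop :=
  S ⊆ T ∧ Stab G S ∧ ∀ R ⊆ T, Stab G R → R.card ≤ S.card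

theorem exists_isMaxStab (G : SimpleGraph V) (T : Finset V) : ∃ S, IsMaxStab G T S := by
  obtain ⟨S, hS, hmax⟩ := (T.powerset.filter fun S => Stab G S).exists_max_image Finset.card
    ⟨∅, Finset.mem_filter.2 ⟨by simp, by simp [Stab]⟩⟩
  simp only [Finset.mem_filter, Finset.mem_powerset] at hS hmax
  exact ⟨S, hS.1, hS.2, fun R hR hs => hmax R ⟨hR, hs⟩⟩

/-- `Q` is a clique in `T` of maximum size. -/
def IsMaxCl (G : SimpleGraph V) (T Q : Finset V) : Prop :=
  Q ⊆ T ∧ G.IsClique (Q : Set V) ∧ Q.card = om G T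

theorem card_inter_le_one {Q S : Finset V} (hQ : G.IsClique (Q : Set V)) (hS : Stab G S) :
    (S ∩ Q).card ≤ 1 := by
  rw [Finset.card_le_one]
  intro a ha b hb
  simp only [Finset.mem_inter] at ha hb
  by_contra hne
  exact hS a ha.1 b hb.1 (hQ ha.2 hb.2 hne)

/-- A properly `k`-coloured clique avoiding the colours in `C` has at most `k - |C|` vertices. -/
theorem card_add_le_of_missing {Q : Finset V} {f : V → ℕ} {k : ℕ} {C : Finset ℕ}
    (hc : G.IsClique (Q : Set V)) (hf : ∀ x ∈ Q, ∀ y ∈ Q, G.Adj x y → f x ≠ f y)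
    (hk : ∀ x ∈ Q, f x < k) (hCk : ∀ i ∈ C, i < k) (hC : ∀ x ∈ Q, f x ∉ C) :
    Q.card + C.card ≤ k := by
  have h1 := card_le_of_colouring (C := Finset.range k \ C) hc hf
    (fun x hx => by simp [hk x hx, hC x hx])
  have hsub : C ⊆ Finset.range k := fun i hi => by simpa using hCk i hi
  have h2 := Finset.card_sdiff_add_card_eq_card hsub
  rw [Finset.card_range] at h2
  omega

namespace MinImp

variable {T : Finset V}

theorem exists_isMaxCl (h : MinImp G T) {S : Finset V} (hS : S ⊆ T) (hs : Stab G S) :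
    ∃ Q, IsMaxCl G T Q ∧ ∀ x ∈ Q, x ∉ S := by
  rcases S.eq_empty_or_nonempty with rfl | hne
  · obtain ⟨Q, hQ, hc, hk⟩ := exists_om G T
    exact ⟨Q, ⟨hQ, hc, hk⟩, by simp⟩
  · obtain ⟨Q, hQ, hc, hk⟩ := h.exists_clique hS hs hne
    exact ⟨Q, ⟨hQ.trans Finset.sdiff_subset, hc, hk⟩, fun x hx => (Finset.mem_sdiff.1 (hQ hx)).2⟩

theorem nonempty (h : MinImp G T) : T.Nonempty := by
  rw [Finset.nonempty_iff_ne_empty]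
  rintro rfl
  exact h.1 ⟨fun _ => 0, by simp, by simp⟩

theorem card_le_of_isMaxStab (h : MinImp G T) {S : Finset V} (hS : IsMaxStab G T S) :
    T.card ≤ S.card * om G T + 1 := by
  obtain ⟨x, hx⟩ := h.nonempty
  obtain ⟨f, f1, f2⟩ := h.colouring_erase (Finset.erase_ssubset hx)
  have h1 : (T.erase x).card ≤ S.card * (Finset.range (om G T)).card := by
    apply Finset.card_le_mul_card_image_of_maps_to (f := f)
    · intro y hy
      simpa using f1 y hy
    · intro k _
      refine hS.2.2 _ ((Finset.filter_subset _ _).trans (Finset.erase_subset _ _)) ?_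
      intro y hy z hz hyz
      rw [Finset.mem_filter] at hy hz
      exact f2 y hy.1 z hz.1 hyz (hy.2.trans hz.2.symm)
  rw [Finset.card_erase_of_mem hx, Finset.card_range] at h1
  omega

open Matrix in
/-- Gasparyan's argument: the size of a minimally imperfect graph, and the uniqueness of a
maximum clique missing a maximum stable set. -/
theorem gasparyan (h : MinImp G T) {S : Finset V} (hS : IsMaxStab G T S) :
    T.card = S.card * om G T + 1 ∧
      ∀ Q R, IsMaxCl G T Q → IsMaxCl G T R → (∀ x ∈ Q, x ∉ S) → (∀ x ∈ R, x ∉ S) → Q = R := by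
  have hcol : ∀ s : S, ∃ f : V → ℕ, (∀ x ∈ T.erase s, f x < om G T) ∧
      ∀ x ∈ T.erase s, ∀ y ∈ T.erase s, G.Adj x y → f x ≠ f y := fun s =>
    h.colouring_erase (Finset.erase_ssubset (hS.1 s.2))
  choose f f1 f2 using hcol
  let St : Option (S × Fin (om G T)) → Finset V := fun i =>
    i.elim S fun p => (T.erase p.1).filter fun x => f p.1 x = p.2
  have hSt : ∀ i, St i ⊆ T ∧ Stab G (St i) := by
    rintro (_ | ⟨s, k⟩)
    · exact ⟨hS.1, hS.2.1⟩
    · refine ⟨(Finset.filter_subset _ _).trans (Finset.erase_subset _ _), ?_⟩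
      intro y hy z hz hyz
      simp only [St, Option.elim, Finset.mem_filter] at hy hz
      exact f2 s y hy.1 z hz.1 hyz (hy.2.trans hz.2.symm)
  have hmiss : ∀ Q, IsMaxCl G T Q → ∀ (s : S) (k : Fin (om G T)),
      (∀ x ∈ Q, x ∉ St (some (s, k))) → (s : V) ∈ Q := by
    intro Q hQ s k hk
    by_contra hs
    have hsub : ∀ x ∈ Q, x ∈ T.erase s := fun x hx => by
      rw [Finset.mem_erase]
      exact ⟨fun he => hs (he ▸ hx), hQ.1 hx⟩
    have := card_add_le_of_missing (C := {(k : ℕ)}) hQ.2.1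
      (fun x hx y hy => f2 s x (hsub x hx) y (hsub y hy)) (fun x hx => f1 s x (hsub x hx))
      (by simp) (fun x hx => by
        have := hk x hx
        simp only [St, Option.elim, Finset.mem_filter, not_and] at this
        simpa using this (hsub x hx))
    rw [hQ.2.2, Finset.card_singleton] at this
    omega
  have huniq : ∀ Q, IsMaxCl G T Q → ∀ i j, (∀ x ∈ Q, x ∉ St i) → (∀ x ∈ Q, x ∉ St j) →
      i = j := by
    rintro Q hQ (_ | ⟨s, k⟩) (_ | ⟨s', k'⟩) hi hj
    · rfl
    · exact (hi _ (hmiss Q hQ s' k' hj) s'.2).elim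
    · exact (hj _ (hmiss Q hQ s k hi) s.2).elim
    · have hs := hmiss Q hQ s k hi
      have hs' := hmiss Q hQ s' k' hj
      obtain rfl : s = s' := by
        by_contra hne
        exact hS.2.1 s s.2 s' s'.2 (hQ.2.1 hs hs' fun he => hne (Subtype.ext he))
      by_contra hne
      have hkk : (k : ℕ) ≠ k' := fun he => hne (by rw [Fin.ext he])
      have hsub : ∀ x ∈ Q.erase s, x ∈ T.erase s :=
        fun x hx => Finset.erase_subset_erase _ hQ.1 hx
      have := card_add_le_of_missing (Q := Q.erase s) (C := {(k : ℕ), (k' : ℕ)})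
        (hQ.2.1.subset (by simp))
        (fun x hx y hy => f2 s x (hsub x hx) y (hsub y hy)) (fun x hx => f1 s x (hsub x hx))
        (by simp) (fun x hx => by
          have h1 := hi x (Finset.mem_of_mem_erase hx)
          have h2 := hj x (Finset.mem_of_mem_erase hx)
          simp only [St, Option.elim, Finset.mem_filter, not_and] at h1 h2
          simp [h1 (hsub x hx), h2 (hsub x hx)])
      rw [Finset.card_pair hkk, Finset.card_erase_of_mem hs, hQ.2.2] at this
      omega
  choose Q hQ hQm using fun i => h.exists_isMaxCl (hSt i).1 (hSt i).2
  let ind : Finset V → T → ℚ := fun A x => if (x : V) ∈ A then 1 else 0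
  have hdot : ∀ A B, A ⊆ T → ind A ⬝ᵥ ind B = ((A ∩ B).card : ℚ) := by
    intro A B hA
    simp only [dotProduct, ind, mul_ite, mul_one, mul_zero]
    rw [Finset.sum_coe_sort T (fun x => if x ∈ B then (if x ∈ A then (1 : ℚ) else 0) else 0)]
    simp only [← ite_and]
    rw [Finset.sum_boole]
    congr 2
    ext x
    have := @hA x
    simp only [Finset.mem_filter, Finset.mem_inter]
    tauto
  have hzero : ∀ A B : Finset V, (∀ x ∈ B, x ∉ A) → (A ∩ B).card = 0 := by
    intro A B hd
    rw [Finset.card_eq_zero, Finset.eq_empty_iff_forall_notMem]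
    intro x hx
    rw [Finset.mem_inter] at hx
    exact hd x hx.2 hx.1
  have hone : ∀ i R, IsMaxCl G T R → ¬ (∀ x ∈ R, x ∉ St i) → (St i ∩ R).card = 1 := by
    intro i R hR hd
    push Not at hd
    obtain ⟨x, hx, hx'⟩ := hd
    refine le_antisymm (card_inter_le_one hR.2.1 (hSt i).2) ?_
    exact Finset.card_pos.2 ⟨x, by simp [*]⟩
  have hmat : ∀ i j, ind (St i) ⬝ᵥ ind (Q j) = if i = j then 0 else 1 := by
    intro i j
    rw [hdot _ _ (hSt i).1]
    split_ifs with hij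
    · subst hij
      simp [hzero _ _ (hQm i)]
    · rw [hone i (Q j) (hQ j) fun hd => hij (huniq _ (hQ j) i j hd (hQm j))]
      simp
  obtain ⟨t, ht⟩ := h.nonempty
  have hωpos : 1 ≤ om G T := om_pos ht
  have hSpos : 1 ≤ S.card := by
    simpa using hS.2.2 {t} (by simpa using ht) (by simp [Stab])
  have hcard : Fintype.card (Option (S × Fin (om G T))) = S.card * om G T + 1 := by
    simp
  have hli := linearIndependent_of_dotProduct hmat (by
    rw [hcard]
    have := Nat.mul_pos hSpos hωpos
    omega)
  have hle := hli.fintype_card_le_finrank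
  rw [hcard] at hle
  simp only [Module.finrank_fintype_fun_eq_card, Fintype.card_coe] at hle
  have heq : T.card = S.card * om G T + 1 := le_antisymm (h.card_le_of_isMaxStab hS) hle
  refine ⟨heq, fun A B hA hB hAS hBS => ?_⟩
  have hv : ind A - ind B = 0 := by
    apply eq_zero_of_dotProduct_eq_zero hli (by rw [hcard, Fintype.card_coe, heq])
    intro i
    rw [dotProduct_sub, hdot _ _ (hSt i).1, hdot _ _ (hSt i).1]
    rcases i with _ | i
    · rw [hzero (St none) A hAS, hzero (St none) B hBS, sub_self]
    · have hA1 := hone (some i) A hA fun hd =>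
        Option.some_ne_none _ (huniq A hA (some i) none hd hAS)
      have hB1 := hone (some i) B hB fun hd =>
        Option.some_ne_none _ (huniq B hB (some i) none hd hBS)
      rw [hA1, hB1, sub_self]
  ext x
  by_cases hx : x ∈ T
  · have := congrFun hv ⟨x, hx⟩
    simp only [ind, Pi.sub_apply, Pi.zero_apply] at this
    by_cases h1 : x ∈ A <;> by_cases h2 : x ∈ B <;> simp_all
  · exact ⟨fun hx' => (hx (hA.1 hx')).elim, fun hx' => (hx (hB.1 hx')).elim⟩

theorem isMaxStab_class (h : MinImp G T) {x : V} (hx : x ∈ T) {f : V → ℕ}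
    (f1 : ∀ y ∈ T.erase x, f y < om G T)
    (f2 : ∀ y ∈ T.erase x, ∀ z ∈ T.erase x, G.Adj y z → f y ≠ f z) {k : ℕ} (hk : k < om G T) :
    IsMaxStab G T ((T.erase x).filter fun y => f y = k) := by
  obtain ⟨S, hS⟩ := exists_isMaxStab G T
  have hst : ∀ k, Stab G ((T.erase x).filter fun y => f y = k) := by
    intro k y hy z hz hyz
    rw [Finset.mem_filter] at hy hz
    exact f2 y hy.1 z hz.1 hyz (hy.2.trans hz.2.symm)
  have hsub : ∀ k, ((T.erase x).filter fun y => f y = k) ⊆ T := fun k =>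
    (Finset.filter_subset _ _).trans (Finset.erase_subset _ _)
  have hle : ∀ k, ((T.erase x).filter fun y => f y = k).card ≤ S.card := fun k =>
    hS.2.2 _ (hsub k) (hst k)
  have hge : S.card ≤ ((T.erase x).filter fun y => f y = k).card := by
    by_contra! hlt
    have h1 := Finset.card_eq_sum_card_fiberwise (s := T.erase x) (t := Finset.range (om G T))
      (f := f) (fun y hy => by simpa using f1 y hy)
    have h2 := Finset.sum_lt_sum (s := Finset.range (om G T)) (fun k _ => hle k)
      ⟨k, by simpa using hk, hlt⟩
    rw [← h1, Finset.card_erase_of_mem hx, Finset.sum_const, Finset.card_range, smul_eq_mul,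
      (h.gasparyan hS).1, mul_comm] at h2
    omega
  exact ⟨hsub k, hst k, fun R hR hs => (hS.2.2 R hR hs).trans hge⟩

/-- Every vertex of a minimally imperfect graph lies in at least `ω` maximum cliques. -/
theorem om_le_card_cliques (h : MinImp G T) {x : V} (hx : x ∈ T) :
    om G T ≤ (T.powerset.filter fun Q => IsMaxCl G T Q ∧ x ∈ Q).card := by
  obtain ⟨f, f1, f2⟩ := h.colouring_erase (Finset.erase_ssubset hx)
  have hex : ∀ k : ℕ, k < om G T → ∃ Q, IsMaxCl G T Q ∧ x ∈ Q ∧ ∀ y ∈ Q.erase x, f y ≠ k := by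
    intro k hk
    have hS := h.isMaxStab_class hx f1 f2 hk
    obtain ⟨Q, hQ, hQS⟩ := h.exists_isMaxCl hS.1 hS.2.1
    have hmiss : ∀ y ∈ Q, y ≠ x → f y ≠ k := by
      intro y hy hyx hfy
      exact hQS y hy (by simp [hQ.1 hy, hyx, hfy])
    refine ⟨Q, hQ, ?_, fun y hy => hmiss y (Finset.mem_of_mem_erase hy) (Finset.ne_of_mem_erase hy)⟩
    by_contra hxQ
    have hne : ∀ y ∈ Q, y ≠ x := fun y hy he => hxQ (he ▸ hy)
    have hsub : ∀ y ∈ Q, y ∈ T.erase x := fun y hy => Finset.mem_erase.2 ⟨hne y hy, hQ.1 hy⟩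
    have := card_add_le_of_missing (C := {k}) hQ.2.1
      (fun y hy z hz => f2 y (hsub y hy) z (hsub z hz)) (fun y hy => f1 y (hsub y hy))
      (by simpa using hk) (fun y hy => by simpa using hmiss y hy (hne y hy))
    rw [hQ.2.2, Finset.card_singleton] at this
    omega
  choose! Q hQ hxQ hQm using hex
  have hinj : Set.InjOn Q (Finset.range (om G T) : Set ℕ) := by
    intro k hk l hl hkl
    simp only [Finset.coe_range, Set.mem_Iio] at hk hl
    by_contra hne
    have hsub : ∀ y ∈ (Q k).erase x, y ∈ T.erase x :=
      fun y hy => Finset.erase_subset_erase _ (hQ k hk).1 hy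
    have := card_add_le_of_missing (Q := (Q k).erase x) (C := {k, l})
      ((hQ k hk).2.1.subset (by simp))
      (fun y hy z hz => f2 y (hsub y hy) z (hsub z hz)) (fun y hy => f1 y (hsub y hy))
      (by simp [hk, hl]) (fun y hy => by
        have h1 := hQm k hk y hy
        have h2 := hQm l hl y (hkl ▸ hy)
        simp [h1, h2])
    rw [Finset.card_pair hne, Finset.card_erase_of_mem (hxQ k hk), (hQ k hk).2.2] at this
    omega
  have := Finset.card_le_card_of_injOn (s := Finset.range (om G T))
    (t := T.powerset.filter fun Q => IsMaxCl G T Q ∧ x ∈ Q) Q (fun k hk => by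
      have hk' : k < om G T := by simpa using hk
      simp [(hQ k hk').1, hQ k hk', hxQ k hk']) hinj
  simpa using this

/-- If `T` is covered by a clique `X` and a set in which the neighbourhoods of the vertices of
`X` are cliques, then the clique number of `T` is at most two. -/
theorem om_le_two (h : MinImp G T) {X : Finset V} (hX : X ⊆ T) (hXc : G.IsClique (X : Set V))
    (hne : X.Nonempty)
    (hN : ∀ x ∈ X, ∀ y ∈ T, ∀ z ∈ T, y ∉ X → z ∉ X → G.Adj x y → G.Adj x z → y ≠ z → G.Adj y z) :
    om G T ≤ 2 := by
  obtain ⟨x₀, hx₀⟩ := hne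
  obtain ⟨f, f1, f2⟩ := h.colouring_erase (Finset.erase_ssubset (hX hx₀))
  have hXω : X.card ≤ om G T := le_om hX hXc
  obtain ⟨b, hb, hbX⟩ : ∃ b < om G T, ∀ x ∈ X.erase x₀, f x ≠ b := by
    have hlt : ((X.erase x₀).image f).card < (Finset.range (om G T)).card := by
      refine Finset.card_image_le.trans_lt ?_
      rw [Finset.card_erase_of_mem hx₀, Finset.card_range]
      have := Finset.card_pos.2 ⟨x₀, hx₀⟩
      omega
    obtain ⟨b, hb, hb'⟩ := Finset.exists_mem_notMem_of_card_lt_card hlt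
    exact ⟨b, by simpa using hb, fun x hx he => hb' (Finset.mem_image.2 ⟨x, hx, he⟩)⟩
  have hS := h.isMaxStab_class (hX hx₀) f1 f2 hb
  set S := (T.erase x₀).filter fun y => f y = b with hSdef
  have hSX : ∀ s ∈ S, s ∉ X := by
    intro s hs hsX
    simp only [hSdef, Finset.mem_filter, Finset.mem_erase] at hs
    exact hbX s (by simp [hs, hsX]) hs.2
  have hex : ∀ x ∈ X, ∃ s ∈ S, G.Adj x s := by
    intro x hx
    by_contra! hno
    have hxS : x ∉ S := fun hs => hSX x hs hx
    have := hS.2.2 (insert x S) (Finset.insert_subset (hX hx) hS.1) (by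
      intro y hy z hz hyz
      rw [Finset.mem_insert] at hy hz
      rcases hy with rfl | hy <;> rcases hz with rfl | hz
      · exact G.irrefl hyz
      · exact hno z hz hyz
      · exact hno y hy hyz.symm
      · exact hS.2.1 y hy z hz hyz)
    rw [Finset.card_insert_of_notMem hxS] at this
    omega
  have hun : ∀ x ∈ X, ∀ s ∈ S, ∀ t ∈ S, G.Adj x s → G.Adj x t → s = t := by
    intro x hx s hs t ht hxs hxt
    by_contra hst
    exact hS.2.1 s hs t ht
      (hN x hx s (hS.1 hs) t (hS.1 ht) (hSX s hs) (hSX t ht) hxs hxt hst)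
  have hcount : ∀ x ∈ X, ∀ β ∈ S, G.Adj x β →
      om G T ≤ (X.filter fun x => G.Adj x β).card + 1 := by
    intro x hx β hβ hxβ
    set Xβ := X.filter fun x => G.Adj x β with hXβ
    have hxX : x ∈ Xβ := by simp [hXβ, hx, hxβ]
    let A := T.powerset.filter fun Q => IsMaxCl G T Q ∧ x ∈ Q
    let A1 := A.filter fun Q => β ∉ Q
    let B : V → Finset (Finset V) := fun x' => A.filter fun Q => β ∈ Q ∧ x' ∉ Q
    let C := A.filter fun Q => β ∈ Q ∧ Xβ ⊆ Q
    have hA : om G T ≤ A.card := h.om_le_card_cliques (hX hx)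
    have hAmem : ∀ Q ∈ A, IsMaxCl G T Q ∧ x ∈ Q := fun Q hQ => (Finset.mem_filter.1 hQ).2
    have hA1 : A1.card ≤ 1 := by
      rw [Finset.card_le_one]
      intro Q hQ R hR
      have key : ∀ Q ∈ A1, ∀ y ∈ Q, y ∉ S := by
        intro Q hQ y hy hyS
        obtain ⟨hQA, hβQ⟩ := Finset.mem_filter.1 hQ
        have hyx : x ≠ y := fun he => hSX y hyS (he ▸ hx)
        exact hβQ (hun x hx β hβ y hyS hxβ ((hAmem Q hQA).1.2.1 (hAmem Q hQA).2 hy hyx) ▸ hy)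
      exact (h.gasparyan hS).2 Q R (hAmem Q (Finset.mem_filter.1 hQ).1).1
        (hAmem R (Finset.mem_filter.1 hR).1).1 (key Q hQ) (key R hR)
    have hB : ∀ x' ∈ Xβ.erase x, (B x').card ≤ 1 := by
      intro x' hx'
      obtain ⟨hx'x, hx'β⟩ := Finset.mem_erase.1 hx'
      obtain ⟨hx'X, hx'adj⟩ := Finset.mem_filter.1 hx'β
      have hx'S : x' ∉ S.erase β := fun hs => hSX x' (Finset.mem_of_mem_erase hs) hx'X
      have hno : ∀ s ∈ S.erase β, ¬ G.Adj x' s := fun s hs hs' =>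
        Finset.ne_of_mem_erase hs (hun x' hx'X s (Finset.mem_of_mem_erase hs) β hβ hs' hx'adj)
      have hS' : IsMaxStab G T (insert x' (S.erase β)) := by
        refine ⟨Finset.insert_subset (hX hx'X) ((Finset.erase_subset _ _).trans hS.1), ?_, ?_⟩
        · intro y hy z hz hyz
          rw [Finset.mem_insert] at hy hz
          rcases hy with rfl | hy <;> rcases hz with rfl | hz
          · exact G.irrefl hyz
          · exact hno z hz hyz
          · exact hno y hy hyz.symm
          · exact hS.2.1 y (Finset.mem_of_mem_erase hy) z (Finset.mem_of_mem_erase hz) hyz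
        · intro R hR hRs
          refine (hS.2.2 R hR hRs).trans ?_
          rw [Finset.card_insert_of_notMem hx'S, Finset.card_erase_of_mem hβ]
          omega
      rw [Finset.card_le_one]
      intro Q hQ R hR
      have key : ∀ Q ∈ B x', ∀ y ∈ Q, y ∉ insert x' (S.erase β) := by
        intro Q hQ y hy hyS
        obtain ⟨hQA, hβQ, hx'Q⟩ := Finset.mem_filter.1 hQ
        rcases Finset.mem_insert.1 hyS with rfl | hyS
        · exact hx'Q hy
        · obtain ⟨hyβ, hyS⟩ := Finset.mem_erase.1 hyS
          exact hS.2.1 y hyS β hβ ((hAmem Q hQA).1.2.1 hy hβQ hyβ)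
      exact (h.gasparyan hS').2 Q R (hAmem Q (Finset.mem_filter.1 hQ).1).1
        (hAmem R (Finset.mem_filter.1 hR).1).1 (key Q hQ) (key R hR)
    have hC : C.card ≤ 1 := by
      rw [Finset.card_le_one]
      intro Q hQ R hR
      obtain ⟨hQA, hβQ, hQX⟩ := Finset.mem_filter.1 hQ
      obtain ⟨hRA, hβR, hRX⟩ := Finset.mem_filter.1 hR
      obtain ⟨hQm, hxQ⟩ := hAmem Q hQA
      obtain ⟨hRm, hxR⟩ := hAmem R hRA
      have hXX : ∀ Q, IsMaxCl G T Q → β ∈ Q → ∀ y ∈ Q, y ∈ X → y ∈ Xβ := by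
        intro Q hQ hβQ y hy hyX
        refine Finset.mem_filter.2 ⟨hyX, hQ.2.1 hy hβQ ?_⟩
        rintro rfl
        exact hSX y hβ hyX
      have hcl : G.IsClique ((Q ∪ R : Finset V) : Set V) := by
        have hcross : ∀ y ∈ Q, ∀ z ∈ R, y ≠ z → G.Adj y z := by
          intro y hy z hz hyz
          by_cases hyX : y ∈ X
          · exact hRm.2.1 (hRX (hXX Q hQm hβQ y hy hyX)) hz hyz
          · by_cases hzX : z ∈ X
            · exact hQm.2.1 hy (hQX (hXX R hRm hβR z hz hzX)) hyz
            · refine hN x hx y (hQm.1 hy) z (hRm.1 hz) hyX hzX (hQm.2.1 hxQ hy ?_)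
                (hRm.2.1 hxR hz ?_) hyz
              · rintro rfl; exact hyX hx
              · rintro rfl; exact hzX hx
        intro y hy z hz hyz
        simp only [Finset.coe_union, Set.mem_union, Finset.mem_coe] at hy hz
        rcases hy with hy | hy <;> rcases hz with hz | hz
        · exact hQm.2.1 hy hz hyz
        · exact hcross y hy z hz hyz
        · exact (hcross z hz y hy hyz.symm).symm
        · exact hRm.2.1 hy hz hyz
      have hle := le_om (Finset.union_subset hQm.1 hRm.1) hcl
      have h1 : Q = Q ∪ R := Finset.eq_of_subset_of_card_le Finset.subset_union_left
        (by rw [hQm.2.2]; exact hle)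
      have h2 : R = Q ∪ R := Finset.eq_of_subset_of_card_le Finset.subset_union_right
        (by rw [hRm.2.2]; exact hle)
      exact h1.trans h2.symm
    have hcover : A ⊆ A1 ∪ C ∪ (Xβ.erase x).biUnion B := by
      intro Q hQ
      by_cases hβQ : β ∈ Q
      · by_cases hsub : Xβ ⊆ Q
        · have : Q ∈ C := Finset.mem_filter.2 ⟨hQ, hβQ, hsub⟩
          simp [this]
        · obtain ⟨x', hx', hx'Q⟩ := Finset.not_subset.1 hsub
          have : Q ∈ (Xβ.erase x).biUnion B := by
            refine Finset.mem_biUnion.2 ⟨x', Finset.mem_erase.2 ⟨?_, hx'⟩,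
              Finset.mem_filter.2 ⟨hQ, hβQ, hx'Q⟩⟩
            rintro rfl
            exact hx'Q (hAmem Q hQ).2
          rw [Finset.mem_union]
          exact .inr this
      · have : Q ∈ A1 := Finset.mem_filter.2 ⟨hQ, hβQ⟩
        simp [this]
    have c1 := Finset.card_le_card hcover
    have c2 := Finset.card_union_le (A1 ∪ C) ((Xβ.erase x).biUnion B)
    have c3 := Finset.card_union_le A1 C
    have c4 := Finset.card_biUnion_le_card_mul (Xβ.erase x) B 1 hB
    rw [Finset.card_erase_of_mem hxX, mul_one] at c4
    have := Finset.card_pos.2 ⟨x, hxX⟩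
    omega
  obtain ⟨β, hβ, hxβ⟩ := hex x₀ hx₀
  obtain ⟨x₂, hx₂, hx₂β⟩ : ∃ x₂ ∈ X, ¬ G.Adj x₂ β := by
    by_contra! hall
    refine h.not_dominated (hX hx₀) (hS.1 hβ) hxβ fun z hz hzx => ?_
    by_cases hzX : z ∈ X
    · exact .inr (hall z hzX)
    · rw [or_iff_not_imp_left]
      exact hN x₀ hx₀ z hz β (hS.1 hβ) hzX (hSX β hβ) hzx.symm hxβ
  obtain ⟨β₂, hβ₂, hxβ₂⟩ := hex x₂ hx₂
  have d1 := hcount x₀ hx₀ β hβ hxβ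
  have d2 := hcount x₂ hx₂ β₂ hβ₂ hxβ₂
  have hdis : Disjoint (X.filter fun x => G.Adj x β) (X.filter fun x => G.Adj x β₂) := by
    rw [Finset.disjoint_left]
    intro y hy hy'
    rw [Finset.mem_filter] at hy hy'
    have := hun y hy.1 β hβ β₂ hβ₂ hy.2 hy'.2
    exact hx₂β (this ▸ hxβ₂)
  have d3 := Finset.card_le_card (Finset.union_subset
    (Finset.filter_subset (fun x => G.Adj x β) X) (Finset.filter_subset (fun x => G.Adj x β₂) X))
  rw [Finset.card_union_of_disjoint hdis] at d3
  omega

end MinImp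

/-- The graph on `V` whose edges are the edges of `G` inside `S`. -/
def inside (G : SimpleGraph V) (S : Set V) : SimpleGraph V where
  Adj a b := a ∈ S ∧ b ∈ S ∧ G.Adj a b
  symm := ⟨fun _ _ h => ⟨h.2.1, h.1, h.2.2.symm⟩⟩
  loopless := ⟨fun _ h => G.irrefl h.2.2⟩

theorem exists_geodesic {p q : V} (h : G.Reachable p q) :
    ∃ (L : ℕ) (g : ℕ → V), g 0 = p ∧ g L = q ∧ (∀ i < L, G.Adj (g i) (g (i + 1))) ∧
      ∀ i ≤ L, G.dist p (g i) = i := by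
  obtain ⟨w, hw⟩ := h.exists_walk_length_eq_dist
  have hadj : ∀ i < w.length, G.Adj (w.getVert i) (w.getVert (i + 1)) :=
    fun i hi => w.adj_getVert_succ hi
  have hstep : ∀ i < w.length, G.dist p (w.getVert (i + 1)) ≤ G.dist p (w.getVert i) + 1 := by
    intro i hi
    have h1 := (hadj i hi).reachable.dist_triangle_right p
    rwa [SimpleGraph.dist_eq_one_iff_adj.2 (hadj i hi)] at h1
  have hup : ∀ i ≤ w.length, G.dist p (w.getVert i) ≤ i := by
    intro i hi
    induction i with
    | zero => simp
    | succ i ih =>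
      have := ih (by omega)
      have := hstep i (by omega)
      omega
  have hlow : ∀ k ≤ w.length, w.length - k ≤ G.dist p (w.getVert (w.length - k)) := by
    intro k hk
    induction k with
    | zero =>
      rw [Nat.sub_zero, w.getVert_length]
      exact hw.le
    | succ k ih =>
      have h1 := ih (by omega)
      have h2 := hstep (w.length - (k + 1)) (by omega)
      rw [show w.length - (k + 1) + 1 = w.length - k by omega] at h2
      omega
  refine ⟨w.length, w.getVert, by simp, by simp, hadj, fun i hi => le_antisymm (hup i hi) ?_⟩
  have := hlow (w.length - i) (by omega)
  rwa [show w.length - (w.length - i) = i by omega] at this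

theorem fin_eq_add_one_iff {L : ℕ} (i j : Fin (L + 2)) :
    j = i + 1 ↔ j.val = i.val + 1 ∨ (i.val = L + 1 ∧ j.val = 0) := by
  have hi := i.is_lt
  have hj := j.is_lt
  rw [Fin.ext_iff, Fin.val_add_one]
  split_ifs with h
  · have : i.val = L + 1 := by rw [h]; rfl
    omega
  · have : i.val ≠ L + 1 := fun he => h (Fin.ext he)
    omega

theorem zmod_eq_add_one_iff {L : ℕ} (i j : ZMod (L + 2)) :
    j = i + 1 ↔ j.val = i.val + 1 ∨ (i.val = L + 1 ∧ j.val = 0) :=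
  fin_eq_add_one_iff i j

/-- An induced path together with a vertex adjacent to exactly its two ends is an induced
cycle. -/
theorem isInducedCycle_of_path {L : ℕ} {g : ℕ → V} {x : V} (hL : 1 ≤ L)
    (hinj : ∀ i ≤ L, ∀ j ≤ L, g i = g j → i = j)
    (hadj : ∀ i ≤ L, ∀ j ≤ L, G.Adj (g i) (g j) ↔ j = i + 1 ∨ i = j + 1)
    (hx : ∀ i ≤ L, x ≠ g i) (hxadj : ∀ i ≤ L, G.Adj x (g i) ↔ i = 0 ∨ i = L) :
    IsInducedCycle G (n := L + 2) fun i => if i.val ≤ L then g i.val else x := by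
  have hlt : ∀ i : ZMod (L + 2), i.val < L + 2 := fun i => ZMod.val_lt i
  constructor
  · intro i j hij
    dsimp only at hij
    apply ZMod.val_injective
    have := hlt i
    have := hlt j
    split_ifs at hij with h1 h2 h2
    · exact hinj _ h1 _ h2 hij
    · exact (hx _ h1 hij.symm).elim
    · exact (hx _ h2 hij).elim
    · omega
  · intro i j
    have := hlt i
    have := hlt j
    rw [zmod_eq_add_one_iff, zmod_eq_add_one_iff]
    dsimp only
    split_ifs with h1 h2 h2
    · rw [hadj _ h1 _ h2]
      omega
    · rw [G.adj_comm, hxadj _ h1]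
      omega
    · rw [hxadj _ h2]
      omega
    · have : i = j := ZMod.val_injective _ (by omega)
      simp only [this, SimpleGraph.irrefl, false_iff]
      omega

/-- An odd hole of `G` inside `T`, enumerated by `c`. -/
def IsOddHole (G : SimpleGraph V) (T : Finset V) (n : ℕ) (c : ZMod n → V) : Prop :=
  5 ≤ n ∧ Odd n ∧ IsInducedCycle G c ∧ ∀ i, c i ∈ T

namespace MinImp

variable {T : Finset V}

/-- If `T` is covered by a clique `X` and a set in which the neighbourhoods of the vertices of
`X` are cliques, then `T` contains an odd hole meeting `X`. -/
theorem exists_oddHole (h : MinImp G T) {X : Finset V} (hX : X ⊆ T)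
    (hXc : G.IsClique (X : Set V)) (hne : X.Nonempty)
    (hN : ∀ x ∈ X, ∀ y ∈ T, ∀ z ∈ T, y ∉ X → z ∉ X → G.Adj x y → G.Adj x z → y ≠ z → G.Adj y z) :
    ∃ (n : ℕ) (c : ZMod n → V), IsOddHole G T n c ∧ ∃ i, c i ∈ X := by
  have hω := h.om_le_two hX hXc hne hN
  obtain ⟨x, hxX⟩ := hne
  have hxT := hX hxX
  have htri : ∀ a ∈ T, ∀ b ∈ T, ∀ c ∈ T, G.Adj a b → G.Adj a c → ¬ G.Adj b c := by
    intro a ha b hb c hc hab hac hbc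
    have h1 : ({a, b, c} : Finset V).card = 3 := by
      rw [Finset.card_eq_three]
      exact ⟨a, b, c, hab.ne, hac.ne, hbc.ne, rfl⟩
    have h2 := le_om (G := G) (S := T) (Q := {a, b, c})
      (by intro y; simp; rintro (rfl | rfl | rfl) <;> assumption) (by
        intro y hy z hz hyz
        simp only [Finset.coe_insert, Finset.coe_singleton, Set.mem_insert_iff,
          Set.mem_singleton_iff] at hy hz
        have := hab.symm
        have := hac.symm
        have := hbc.symm
        rcases hy with rfl | rfl | rfl <;> rcases hz with rfl | rfl | rfl <;>
          first | assumption | exact (hyz rfl).elim)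
    omega
  have hnbr : ∀ a ∈ T, ∀ b ∈ T, ∀ c ∈ T, G.Adj x a → G.Adj x b → G.Adj x c →
      a = b ∨ a = c ∨ b = c := by
    intro a ha b hb c hc hxa hxb hxc
    have key : ∀ a ∈ T, ∀ b ∈ T, G.Adj x a → G.Adj x b → (a ∈ X ↔ b ∈ X) → a = b := by
      intro a ha b hb hxa hxb hab
      by_contra hne
      refine htri x hxT a ha b hb hxa hxb ?_
      by_cases haX : a ∈ X
      · exact hXc haX (hab.1 haX) hne
      · exact hN x hxX a ha b hb haX (fun hb => haX (hab.2 hb)) hxa hxb hne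
    by_contra! hcon
    have h1 := fun hh => hcon.1 (key a ha b hb hxa hxb hh)
    have h2 := fun hh => hcon.2.1 (key a ha c hc hxa hxc hh)
    have h3 := fun hh => hcon.2.2 (key b hb c hc hxb hxc hh)
    tauto
  obtain ⟨f, f1, f2⟩ := h.colouring_erase (Finset.erase_ssubset hxT)
  have hcol : ∀ g : V → ℕ, (∀ y ∈ T.erase x, g y < 2) →
      (∀ y ∈ T.erase x, ∀ z ∈ T.erase x, G.Adj y z → g y ≠ g z) →
      ∀ k < 2, ∃ y ∈ T, G.Adj x y ∧ g y = k := by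
    intro g g1 g2 k hk
    by_contra! hno
    have hω2 : 2 ≤ om G T := by
      obtain ⟨y, hy, hxy⟩ := h.exists_adj hxT
      have := le_om (G := G) (S := T) (Q := {x, y})
        (by intro z; simp; rintro (rfl | rfl) <;> assumption) (by
          simpa using fun _ => hxy)
      rwa [Finset.card_pair hxy.ne] at this
    refine h.1 ⟨fun y => if y = x then k else g y, fun y hy => ?_, fun y hy z hz hyz => ?_⟩
    · dsimp only
      split_ifs with he
      · omega
      · have := g1 y (by simp [*])
        omega
    · dsimp only
      split_ifs with h1 h2 h2
      · subst h1 h2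
        exact (G.irrefl hyz).elim
      · subst h1
        exact (hno z hz hyz).symm
      · subst h2
        exact hno y hy hyz.symm
      · exact g2 y (by simp [*]) z (by simp [*]) hyz
  have f1' : ∀ y ∈ T.erase x, f y < 2 := fun y hy => (f1 y hy).trans_le hω
  obtain ⟨p, hp, hxp, hfp⟩ := hcol f f1' f2 0 (by omega)
  obtain ⟨q, hq, hxq, hfq⟩ := hcol f f1' f2 1 (by omega)
  have hpq : p ≠ q := by
    rintro rfl
    omega
  set H := inside G (T.erase x : Finset V) with hH
  have hHadj : ∀ a b, H.Adj a b ↔ a ∈ T.erase x ∧ b ∈ T.erase x ∧ G.Adj a b := fun a b => Iff.rfl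
  have hreach : H.Reachable p q := by
    by_contra hno
    obtain ⟨y, hy, hxy, hgy⟩ := hcol
      (fun y => if H.Reachable p y then 1 - f y else f y) (fun y hy => by
        have := f1' y hy
        split_ifs <;> omega) (fun y hy z hz hyz => by
        have := f1' y hy
        have := f1' z hz
        have := f2 y hy z hz hyz
        have hyz' : H.Adj y z := ⟨hy, hz, hyz⟩
        have hiff : H.Reachable p y ↔ H.Reachable p z :=
          ⟨fun hr => hr.trans hyz'.reachable, fun hr => hr.trans hyz'.symm.reachable⟩
        simp only [hiff]
        split_ifs <;> omega) 0 (by omega)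
    rcases hnbr y hy p hp q hq hxy hxp hxq with rfl | rfl | he
    · simp [hfp] at hgy
    · simp [hno, hfq] at hgy
    · exact hpq he
  obtain ⟨L, g, hg0, hgL, hgadj, hgd⟩ := exists_geodesic hreach
  have hLpos : 1 ≤ L := by
    by_contra! hL
    obtain rfl : L = 0 := by omega
    exact hpq (hg0.symm.trans hgL)
  have hgT : ∀ i ≤ L, g i ∈ T.erase x := by
    intro i hi
    by_cases hiL : i < L
    · exact (hgadj i hiL).1
    · obtain rfl : i = L := by omega
      have := (hgadj (i - 1) (by omega)).2.1
      rwa [show i - 1 + 1 = i by omega] at this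
  have hgT' : ∀ i ≤ L, g i ∈ T := fun i hi => Finset.mem_of_mem_erase (hgT i hi)
  have hinj : ∀ i ≤ L, ∀ j ≤ L, g i = g j → i = j := by
    intro i hi j hj hij
    rw [← hgd i hi, ← hgd j hj, hij]
  have hadj : ∀ i ≤ L, ∀ j ≤ L, G.Adj (g i) (g j) ↔ j = i + 1 ∨ i = j + 1 := by
    intro i hi j hj
    constructor
    · intro hij
      have hij' : H.Adj (g i) (g j) := ⟨hgT i hi, hgT j hj, hij⟩
      have := hij'.diff_dist_adj (u := p)
      rw [hgd i hi, hgd j hj] at this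
      have hne : i ≠ j := by
        rintro rfl
        exact G.irrefl hij
      omega
    · rintro (rfl | rfl)
      · exact (hgadj i (by omega)).2.2
      · exact (hgadj j (by omega)).2.2.symm
  have hcolour : ∀ i ≤ L, f (g i) = i % 2 := by
    intro i hi
    induction i with
    | zero => rw [hg0, hfp]
    | succ i ih =>
      have h1 := ih (by omega)
      have h2 := f1' _ (hgT (i + 1) hi)
      have h3 := f2 _ (hgT i (by omega)) _ (hgT (i + 1) hi) (hgadj i (by omega)).2.2
      omega
  have hodd : L % 2 = 1 := by
    rw [← hcolour L le_rfl, hgL, hfq]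
  have hL1 : L ≠ 1 := by
    rintro rfl
    have := (hgadj 0 (by omega)).2.2
    rw [hg0, zero_add, hgL] at this
    exact htri x hxT p hp q hq hxp hxq this
  have hxadj : ∀ i ≤ L, G.Adj x (g i) ↔ i = 0 ∨ i = L := by
    intro i hi
    constructor
    · intro hxi
      rcases hnbr (g i) (hgT' i hi) p hp q hq hxi hxp hxq with he | he | he
      · exact .inl (hinj i hi 0 (by omega) (he.trans hg0.symm))
      · exact .inr (hinj i hi L le_rfl (he.trans hgL.symm))
      · exact (hpq he).elim
    · rintro (rfl | rfl)
      · rwa [hg0]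
      · rwa [hgL]
  have hxg : ∀ i ≤ L, x ≠ g i := fun i hi he => Finset.ne_of_mem_erase (hgT i hi) he.symm
  refine ⟨L + 2, _, ⟨by omega, ?_, isInducedCycle_of_path hLpos hinj hadj hxg hxadj, ?_⟩,
    ((L + 1 : ℕ) : ZMod (L + 2)), ?_⟩
  · rw [Nat.odd_iff]
    omega
  · intro i
    split_ifs with hi
    · exact hgT' _ hi
    · exact hxT
  · rw [ZMod.val_natCast_of_lt (by omega)]
    simpa using hxX

end MinImp

/-- A fork with centre `c`, leaves `a` and `b`, and long leg `d`, `e`. -/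
theorem fork_elim (hf : ForkFree G) {c a b d e : V} (hca : G.Adj c a) (hcb : G.Adj c b)
    (hcd : G.Adj c d) (hde : G.Adj d e) (hab : ¬ G.Adj a b) (hne : a ≠ b) (had : ¬ G.Adj a d)
    (hbd : ¬ G.Adj b d) (hae : ¬ G.Adj a e) (hbe : ¬ G.Adj b e) (hce : ¬ G.Adj c e) : False := by
  have nad : a ≠ d := by rintro rfl; exact hae hde
  have nbd : b ≠ d := by rintro rfl; exact hbe hde
  have nae : a ≠ e := by rintro rfl; exact hce hca
  have nbe : b ≠ e := by rintro rfl; exact hce hcb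
  have nce : c ≠ e := by rintro rfl; exact hae hca.symm
  refine hf.false ⟨⟨![a, b, c, d, e], ?_⟩, ?_⟩
  · intro i j hij
    have := hca.ne
    have := hcb.ne
    have := hcd.ne
    have := hde.ne
    fin_cases i <;> fin_cases j <;> simp_all
  · intro i j
    change G.Adj (![a, b, c, d, e] i) (![a, b, c, d, e] j) ↔ fork.Adj i j
    have h1 := hca.symm
    have h2 := hcb.symm
    have h3 := hcd.symm
    have h4 := hde.symm
    have h5 := mt (G.adj_symm (u := b) (v := a)) hab
    have h6 := mt (G.adj_symm (u := d) (v := a)) had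
    have h7 := mt (G.adj_symm (u := d) (v := b)) hbd
    have h8 := mt (G.adj_symm (u := e) (v := a)) hae
    have h9 := mt (G.adj_symm (u := e) (v := b)) hbe
    have h10 := mt (G.adj_symm (u := e) (v := c)) hce
    fin_cases i <;> fin_cases j <;> simp [fork, *]

theorem parachute_elim (hp : OddParachuteFree G) {n : ℕ} (hn : 5 ≤ n) (ho : Odd n)
    {c : ZMod n → V} (hc : IsInducedCycle G c) {u w : V} (hu : ∀ i, G.Adj u (c i))
    (huw : G.Adj u w) (hw : ∀ i, ¬ G.Adj w (c i)) : False := by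
  have hwc : ∀ i, w ≠ c i := by
    rintro i rfl
    exact hw (i + 1) ((hc.2 _ _).2 (.inl rfl))
  have huc : ∀ i, u ≠ c i := fun i => (hu i).ne
  have hw' : ∀ i, ¬ G.Adj (c i) w := fun i h => hw i h.symm
  refine (hp n hn ho).false ⟨⟨Sum.elim c ![u, w], ?_⟩, ?_⟩
  · rintro (i | i) (j | j) hij
    · exact congrArg Sum.inl (hc.1 hij)
    · fin_cases j
      · exact (huc i hij.symm).elim
      · exact (hwc i hij.symm).elim
    · fin_cases i
      · exact (huc j hij).elim
      · exact (hwc j hij).elim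
    · have := huw.ne
      have := this.symm
      fin_cases i <;> fin_cases j <;> simp_all
  · intro i j
    change G.Adj (Sum.elim c ![u, w] i) (Sum.elim c ![u, w] j) ↔ (oddParachute n).Adj i j
    rcases i with i | i <;> rcases j with j | j
    · have hne : i ≠ j ∧ (j = i + 1 ∨ i = j + 1) ↔ (j = i + 1 ∨ i = j + 1) := by
        refine and_iff_right_of_imp fun h hij => ?_
        subst hij
        have h1 := (hc.2 i i).2 h
        exact G.irrefl h1
      simpa [oddParachute, hc.2] using hne.symm
    · fin_cases j <;> simp [oddParachute, (hu i).symm, hw' i]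
    · fin_cases i <;> simp [oddParachute, hu j, hw j]
    · have := huw.symm
      fin_cases i <;> fin_cases j <;> simp [oddParachute, *]

/-- An odd hole of `G`, enumerated periodically by the integers. -/
def IsHole (G : SimpleGraph V) (d : ℤ → V) : Prop :=
  ∃ (n : ℕ) (c : ZMod n → V), 5 ≤ n ∧ Odd n ∧ IsInducedCycle G c ∧ ∀ k : ℤ, d k = c k

namespace IsHole

variable {d : ℤ → V}

theorem shift (h : IsHole G d) (m : ℤ) : IsHole G fun k => d (m + k) := by
  obtain ⟨n, c, hn, ho, hc, hd⟩ := h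
  refine ⟨n, fun i => c (m + i), hn, ho, ⟨fun i j hij => ?_, fun i j => ?_⟩, fun k => ?_⟩
  · simpa using hc.1 hij
  · rw [hc.2, add_assoc, add_assoc, add_right_inj, add_right_inj]
  · simp [hd]

theorem reflect (h : IsHole G d) (m : ℤ) : IsHole G fun k => d (m - k) := by
  obtain ⟨n, c, hn, ho, hc, hd⟩ := h
  refine ⟨n, fun i => c (m - i), hn, ho, ⟨fun i j hij => ?_, fun i j => ?_⟩, fun k => ?_⟩
  · simpa using hc.1 hij
  · rw [hc.2]
    constructor
    · rintro (h | h)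
      · exact .inr (by linear_combination h)
      · exact .inl (by linear_combination h)
    · rintro (h | h)
      · exact .inr (by linear_combination h)
      · exact .inl (by linear_combination h)
  · simp [hd]

theorem add_congr (h : IsHole G d) {k l : ℤ} (hkl : d k = d l) (m : ℤ) :
    d (k + m) = d (l + m) := by
  obtain ⟨n, c, hn, ho, hc, hd⟩ := h
  rw [hd, hd] at hkl ⊢
  push_cast
  rw [hc.1 hkl]

theorem adj_iff (h : IsHole G d) (k l : ℤ) :
    G.Adj (d k) (d l) ↔ d l = d (k + 1) ∨ d l = d (k - 1) := by
  obtain ⟨n, c, hn, ho, hc, hd⟩ := h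
  rw [hd, hd, hd, hd, hc.2, hc.1.eq_iff, hc.1.eq_iff]
  push_cast
  refine or_congr Iff.rfl ?_
  rw [eq_sub_iff_add_eq, eq_comm]

theorem adj_succ (h : IsHole G d) (k : ℤ) : G.Adj (d k) (d (k + 1)) :=
  (h.adj_iff _ _).2 (.inl rfl)

theorem ne (h : IsHole G d) {k l : ℤ} (h1 : k < l) (h2 : l ≤ k + 4) : d k ≠ d l := by
  obtain ⟨n, c, hn, ho, hc, hd⟩ := h
  rw [hd, hd, hc.1.ne_iff, Ne, ZMod.intCast_eq_intCast_iff_dvd_sub]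
  intro hdvd
  have := Int.le_of_dvd (by omega) hdvd
  omega

theorem ne' (h : IsHole G d) {k l : ℤ} (h1 : k < l) (h2 : l ≤ k + 4) : d l ≠ d k :=
  (h.ne h1 h2).symm

theorem not_adj (h : IsHole G d) {k l : ℤ} (h1 : k + 2 ≤ l) (h2 : l ≤ k + 3) :
    ¬ G.Adj (d k) (d l) := by
  rw [h.adj_iff]
  rintro (he | he)
  · exact h.ne (k := k + 1) (l := l) (by omega) (by omega) he.symm
  · exact h.ne (k := k - 1) (l := l) (by omega) (by omega) he.symm

theorem not_adj' (h : IsHole G d) {k l : ℤ} (h1 : k + 2 ≤ l) (h2 : l ≤ k + 3) :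
    ¬ G.Adj (d l) (d k) := fun ha => h.not_adj h1 h2 ha.symm

theorem exists_not_adj (h : IsHole G d) (hp : OddParachuteFree G) {u w : V} (huw : G.Adj u w)
    (hw : ∀ k, ¬ G.Adj w (d k)) {k : ℤ} (hk : G.Adj u (d k)) :
    ∃ j, G.Adj u (d j) ∧ ¬ G.Adj u (d (j + 1)) := by
  by_contra! hall
  obtain ⟨n, c, hn, ho, hc, hd⟩ := h
  have hm : ∀ m : ℕ, G.Adj u (d (k + m)) := by
    intro m
    induction m with
    | zero => simpa using hk
    | succ m ih =>
      have := hall _ ih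
      push_cast
      rwa [← add_assoc]
  have : NeZero n := ⟨by omega⟩
  refine parachute_elim hp hn ho hc (fun i => ?_) huw (fun i hi => ?_)
  · have := hm (i - k).val
    rw [hd] at this
    simpa using this
  · apply hw (i.val : ℤ)
    rw [hd]
    simpa using hi

/-- The possible attachments to a hole of a vertex having a neighbour anticomplete to the hole. -/
theorem attachment (h : IsHole G d) (hf : ForkFree G) (hp : OddParachuteFree G) {u w : V}
    (huw : G.Adj u w) (hw : ∀ k, ¬ G.Adj w (d k)) {k : ℤ} (hk : G.Adj u (d k)) :
    ∃ j, ∀ i, G.Adj u (d i) ↔ d i = d j ∨ d i = d (j + 1) := by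
  have hwd : ∀ i, w ≠ d i := by
    rintro i rfl
    exact hw (i + 1) (h.adj_succ i)
  have hw' : ∀ i, ¬ G.Adj (d i) w := fun i hi => hw i hi.symm
  have hun : ∀ j, G.Adj u (d j) → ¬ (¬ G.Adj u (d (j - 1)) ∧ ¬ G.Adj u (d (j + 1))) := by
    rintro j hj ⟨h1, h2⟩
    have h3 := h.adj_succ (j - 1)
    rw [sub_add_cancel] at h3
    exact fork_elim hf h3.symm (h.adj_succ j) hj.symm huw
      (h.not_adj (by omega) (by omega)) (h.ne (by omega) (by omega))
      (fun hh => h1 hh.symm) (fun hh => h2 hh.symm) (hw' _) (hw' _) (hw' _)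
  obtain ⟨j, hj, hj1⟩ := h.exists_not_adj hp huw hw hk
  have hjm : G.Adj u (d (j - 1)) := by
    by_contra hno
    exact hun j hj ⟨hno, hj1⟩
  have hother : ∀ i, G.Adj u (d i) → d i = d j ∨ d i = d (j - 1) ∨ d i = d (j + 2) := by
    intro i hi
    by_contra! hno
    have h1 : d i ≠ d (j + 1) := fun he => hj1 (he ▸ hi)
    refine fork_elim hf huw hi hj (h.adj_succ j) (hw i) (hwd i) (hw j) ?_ (hw _) ?_ hj1
    · rw [G.adj_comm, h.adj_iff]
      tauto
    · rw [G.adj_comm, h.adj_iff]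
      rintro (he | he)
      · exact hno.2.2 (by rw [he]; congr 1; ring)
      · exact hno.1 (by rw [he]; congr 1; ring)
  have hj2 : ¬ G.Adj u (d (j + 2)) := by
    intro h2
    have h3 : G.Adj u (d (j + 3)) := by
      by_contra hno
      refine hun (j + 2) h2 ⟨?_, ?_⟩
      · rwa [show j + 2 - 1 = j + 1 by ring]
      · rwa [show j + 2 + 1 = j + 3 by ring]
    rcases hother _ h3 with he | he | he
    · exact h.ne' (by omega) (by omega) he
    · exact h.ne' (by omega) (by omega) he
    · exact h.ne' (by omega) (by omega) he
  refine ⟨j - 1, fun i => ?_⟩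
  rw [sub_add_cancel]
  constructor
  · intro hi
    rcases hother i hi with he | he | he
    · exact .inr he
    · exact .inl he
    · exact (hj2 (he ▸ hi)).elim
  · rintro (he | he)
    · rwa [he]
    · rwa [he]

end IsHole

/-- `H` can be split into a perfect part and a part of smaller clique number. -/
def Good (G : SimpleGraph V) (H : Finset V) : Prop :=
  ∃ A ⊆ H, Perf G A ∧ om G (H \ A) < om G H

/-- A smallest obstruction to perfect divisibility. -/
def MinBad (G : SimpleGraph V) (H : Finset V) : Prop :=
  ¬ Good G H ∧ ∀ S ⊂ H, S.Nonempty → Good G S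

theorem om_eq_of_embedding {W : Type*} {K : SimpleGraph W} (φ : K ↪g G) {T : Finset V}
    (hT : Set.range φ = T) : IsGreatest {n | ∃ s : Finset W, K.IsNClique n s} (om G T) := by
  constructor
  · obtain ⟨Q, hQ, hc, hk⟩ := exists_om G T
    have hmap : (Q.preimage φ φ.injective.injOn).map φ.toEmbedding = Q := by
      ext x
      simp only [Finset.mem_map, Finset.mem_preimage]
      constructor
      · rintro ⟨y, hy, rfl⟩
        exact hy
      · intro hx
        have : x ∈ Set.range φ := by rw [hT]; exact hQ hx
        obtain ⟨y, rfl⟩ := this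
        exact ⟨y, hx, rfl⟩
    refine ⟨Q.preimage φ φ.injective.injOn, ?_, ?_⟩
    · intro a ha b hb hab
      simp only [Finset.coe_preimage, Set.mem_preimage, Finset.mem_coe] at ha hb
      exact φ.map_adj_iff.1 (hc ha hb (φ.injective.ne hab))
    · rw [← hk, ← Finset.card_map φ.toEmbedding, hmap]
  · rintro n ⟨s, hs, rfl⟩
    rw [← Finset.card_map φ.toEmbedding]
    apply le_om
    · intro x hx
      obtain ⟨y, _, rfl⟩ := Finset.mem_map.1 hx
      have : φ y ∈ Set.range φ := ⟨y, rfl⟩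
      rw [hT] at this
      exact this
    · intro a ha b hb hab
      simp only [Finset.coe_map, Set.mem_image, Finset.mem_coe] at ha hb
      obtain ⟨a, ha, rfl⟩ := ha
      obtain ⟨b, hb, rfl⟩ := hb
      exact φ.map_adj_iff.2 (hs ha hb fun he => hab (congrArg _ he))

theorem cliqueNumber_eq_om {W : Type*} {K : SimpleGraph W} (φ : K ↪g G) {T : Finset V}
    (hT : Set.range φ = T) : cliqueNumber K = om G T :=
  (om_eq_of_embedding φ hT).csSup_eq

theorem colorable_of_col {W : Type*} {K : SimpleGraph W} (φ : K ↪g G) {T : Finset V}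
    (hT : Set.range φ = T) {k : ℕ} (h : Col G T k) : K.Colorable k := by
  obtain ⟨f, h1, h2⟩ := h
  have hmem : ∀ x, φ x ∈ T := fun x => by
    have : φ x ∈ Set.range φ := ⟨x, rfl⟩
    rw [hT] at this
    exact this
  refine ⟨SimpleGraph.Coloring.mk (fun x => ⟨f (φ x), h1 _ (hmem x)⟩) fun {x y} hxy he => ?_⟩
  rw [Fin.mk.injEq] at he
  exact h2 _ (hmem x) _ (hmem y) (φ.map_adj_iff.2 hxy) he

theorem chromaticNumber_eq_cliqueNumber {W : Type*} {K : SimpleGraph W} (φ : K ↪g G)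
    {T : Finset V} (hT : Set.range φ = T) (h : Col G T (om G T)) :
    K.chromaticNumber = (cliqueNumber K : ℕ∞) := by
  rw [cliqueNumber_eq_om φ hT]
  refine le_antisymm (colorable_of_col φ hT h).chromaticNumber_le ?_
  obtain ⟨s, hs, hk⟩ := (om_eq_of_embedding φ hT).1
  rw [← hk]
  exact hs.card_le_chromaticNumber

theorem isPerfectGraph_of_perf {A : Finset V} (h : Perf G A) :
    IsPerfectGraph (G.induce (A : Set V)) := by
  intro S
  let φ : (G.induce (A : Set V)).induce S ↪g G :=
    (SimpleGraph.Embedding.induce S).trans (SimpleGraph.Embedding.induce (A : Set V))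
  have hsub : Set.range φ ⊆ A := by
    rintro _ ⟨y, rfl⟩
    exact y.1.2
  have hfin : (Set.range φ).Finite := A.finite_toSet.subset hsub
  refine chromaticNumber_eq_cliqueNumber φ (T := hfin.toFinset) (by simp) (h _ ?_)
  intro x hx
  exact hsub (by simpa using hx)

theorem cliqueNumber_induce (G : SimpleGraph V) (A : Finset V) :
    cliqueNumber (G.induce (A : Set V)) = om G A :=
  cliqueNumber_eq_om (SimpleGraph.Embedding.induce (A : Set V)) (by
    ext x
    constructor
    · rintro ⟨y, rfl⟩
      exact y.2
    · exact fun hx => ⟨⟨x, hx⟩, rfl⟩)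

theorem perfectlyDivisible_of_good [Finite V] (h : ∀ H : Finset V, H.Nonempty → Good G H) :
    PerfectlyDivisible G := by
  intro S hS
  obtain ⟨H, rfl⟩ := S.toFinite.exists_finset_coe
  obtain ⟨A, hA, hp, hlt⟩ := h H (by simpa using hS)
  refine ⟨A, (H \ A : Finset V), ?_, ?_, isPerfectGraph_of_perf hp, ?_⟩
  · simpa using hA
  · simp
  · rw [cliqueNumber_induce, cliqueNumber_induce]
    exact hlt

theorem exists_minBad [Finite V] (h : ¬ PerfectlyDivisible G) :
    ∃ H : Finset V, H.Nonempty ∧ MinBad G H := by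
  by_contra! hno
  refine h (perfectlyDivisible_of_good fun H => ?_)
  induction H using Finset.strongInduction with
  | H H ih =>
    intro hne
    by_contra hbad
    exact hno H hne ⟨hbad, ih⟩

/-- Replacing a vertex of a perfect graph by a perfect graph gives a perfect graph. -/
theorem Perf.substitute {P L : Finset V} {k : V} (hP : Perf G (insert k P)) (hL : Perf G L)
    (hadj : ∀ l ∈ L, ∀ p ∈ P, G.Adj l p ↔ G.Adj k p) : Perf G (P ∪ L) := by
  by_contra hno
  obtain ⟨T, hT, hm⟩ := exists_minImp hno
  have hTP : ∀ z ∈ T, z ∉ L → z ∈ P := fun z hz hzL => by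
    have := hT hz
    rw [Finset.mem_union] at this
    tauto
  by_cases h2 : 2 ≤ (T ∩ L).card
  · by_cases hTL : T ⊆ L
    · exact hL.not_minImp hTL hm
    refine hm.not_homogeneous (K := T ∩ L) ?_ h2 fun z hz hzK => ?_
    · refine Finset.ssubset_iff_subset_ne.2 ⟨Finset.inter_subset_left, fun he => hTL ?_⟩
      exact Finset.inter_eq_left.1 he
    · have hzP := hTP z hz fun hzL => hzK (Finset.mem_inter.2 ⟨hz, hzL⟩)
      by_cases hkz : G.Adj k z
      · exact .inl fun l hl => ((hadj l (Finset.mem_inter.1 hl).2 z hzP).2 hkz).symm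
      · exact .inr fun l hl hzl => hkz ((hadj l (Finset.mem_inter.1 hl).2 z hzP).1 hzl.symm)
  · rcases (T ∩ L).eq_empty_or_nonempty with he | ⟨l, hl⟩
    · refine (hP.mono (Finset.subset_insert _ _)).not_minImp (fun z hz => hTP z hz fun hzL => ?_) hm
      exact Finset.notMem_empty z (he ▸ Finset.mem_inter.2 ⟨hz, hzL⟩)
    obtain ⟨hlT, hlL⟩ := Finset.mem_inter.1 hl
    have hTl : ∀ z ∈ T, z ≠ l → z ∈ P := by
      refine fun z hz hzl => hTP z hz fun hzL => h2 ?_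
      exact Finset.one_lt_card.2 ⟨z, Finset.mem_inter.2 ⟨hz, hzL⟩, l, hl, hzl⟩
    set T' := insert k (T.erase l) with hT'
    have hT'P : T' ⊆ insert k P := by
      refine Finset.insert_subset_insert k fun z hz => ?_
      exact hTl z (Finset.mem_of_mem_erase hz) (Finset.ne_of_mem_erase hz)
    have hle : om G T' ≤ om G T := by
      obtain ⟨Q, hQ, hQc, hQk⟩ := exists_om G T'
      rw [← hQk]
      have hQT : ∀ z ∈ Q, z ≠ k → z ∈ T.erase l := fun z hz hzk => by
        have := hQ hz
        rw [hT', Finset.mem_insert] at this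
        tauto
      by_cases hkQ : k ∈ Q
      · have hlQ : l ∉ Q.erase k := fun hlQ => by
          have := hQT l (Finset.mem_of_mem_erase hlQ) (Finset.ne_of_mem_erase hlQ)
          simp at this
        have hcard : (insert l (Q.erase k)).card = Q.card := by
          rw [Finset.card_insert_of_notMem hlQ, Finset.card_erase_add_one hkQ]
        rw [← hcard]
        apply le_om
        · refine Finset.insert_subset hlT fun z hz => ?_
          exact Finset.mem_of_mem_erase
            (hQT z (Finset.mem_of_mem_erase hz) (Finset.ne_of_mem_erase hz))
        · rw [Finset.coe_insert, SimpleGraph.isClique_insert]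
          refine ⟨hQc.subset (by simp), fun b hb _ => ?_⟩
          obtain ⟨hbk, hbQ⟩ := Finset.mem_erase.1 (Finset.mem_coe.1 hb)
          obtain ⟨hbl, hbT⟩ := Finset.mem_erase.1 (hQT b hbQ hbk)
          exact (hadj l hlL b (hTl b hbT hbl)).2 (hQc hkQ hbQ hbk.symm)
      · exact le_om (fun z hz => Finset.mem_of_mem_erase (hQT z hz fun he => hkQ (he ▸ hz))) hQc
    obtain ⟨f, f1, f2⟩ := hP T' hT'P
    have hkT' : k ∈ T' := Finset.mem_insert_self _ _
    have hmem : ∀ z ∈ T, z ≠ l → z ∈ T' := fun z hz hzl =>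
      Finset.mem_insert_of_mem (Finset.mem_erase.2 ⟨hzl, hz⟩)
    refine hm.1 ⟨fun z => if z = l then f k else f z, fun z hz => ?_, fun y hy z hz hyz => ?_⟩
    · dsimp only
      split_ifs with h1
      · exact (f1 k hkT').trans_le hle
      · exact (f1 z (hmem z hz h1)).trans_le hle
    · dsimp only
      split_ifs with h1 h2 h2
      · subst h1 h2
        exact (G.irrefl hyz).elim
      · subst h1
        exact f2 k hkT' z (hmem z hz h2) ((hadj y hlL z (hTl z hz h2)).1 hyz)
      · subst h2
        exact f2 y (hmem y hy h1) k hkT' ((hadj z hlL y (hTl y hy h1)).1 hyz.symm).symm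
      · exact f2 y (hmem y hy h1) z (hmem z hz h2) hyz

namespace MinBad

variable {H : Finset V}

/-- Homogeneous sets of a smallest obstruction are cliques. -/
theorem not_homogeneous (h : MinBad G H) {K : Finset V} (hK : K ⊂ H)
    (hnc : ¬ G.IsClique (K : Set V))
    (hom : ∀ z ∈ H, z ∉ K → (∀ k ∈ K, G.Adj z k) ∨ ∀ k ∈ K, ¬ G.Adj z k) : False := by
  obtain ⟨K', hK', hK'c, hK'k⟩ := exists_om G K
  have hKne : K.Nonempty := by
    rw [Finset.nonempty_iff_ne_empty]
    rintro rfl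
    simp at hnc
  obtain ⟨x, hx⟩ := hKne
  have hK'ne : K'.Nonempty := by
    rw [← Finset.card_pos, hK'k]
    exact om_pos hx
  have hH'sub : (H \ K) ∪ K' ⊆ H := Finset.union_subset Finset.sdiff_subset (hK'.trans hK.subset)
  have hH' : (H \ K) ∪ K' ⊂ H := by
    refine Finset.ssubset_iff_subset_ne.2 ⟨hH'sub, fun he => hnc ?_⟩
    refine hK'c.subset fun z hz => ?_
    have hzH : z ∈ (H \ K) ∪ K' := by rw [he]; exact hK.subset hz
    rw [Finset.mem_union, Finset.mem_sdiff] at hzH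
    exact hzH.resolve_left fun hh => hh.2 hz
  obtain ⟨A', hA', hA'p, hA'lt⟩ := h.2 _ hH' (hK'ne.mono Finset.subset_union_right)
  obtain ⟨L, hL, hLp, hLlt⟩ := h.2 K hK ⟨x, hx⟩
  have hle : om G ((H \ K) ∪ K') ≤ om G H := om_mono hH'sub
  have hrep : ∀ Q ⊆ H, G.IsClique (Q : Set V) → (Q ∩ K).Nonempty →
      G.IsClique ((Q \ K ∪ K' : Finset V) : Set V) ∧
      (Q \ K ∪ K').card + (Q ∩ K).card = Q.card + K'.card := by
    rintro Q hQ hQc ⟨q, hq⟩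
    obtain ⟨hqQ, hqK⟩ := Finset.mem_inter.1 hq
    have hcross : ∀ a ∈ Q \ K, ∀ b ∈ K', G.Adj a b := by
      intro a ha b hb
      obtain ⟨haQ, haK⟩ := Finset.mem_sdiff.1 ha
      have haq : G.Adj a q := hQc haQ hqQ (by rintro rfl; exact haK hqK)
      rcases hom a (hQ haQ) haK with h1 | h1
      · exact h1 b (hK' hb)
      · exact (h1 q hqK haq).elim
    constructor
    · intro a ha b hb hab
      rw [Finset.mem_coe, Finset.mem_union] at ha hb
      rcases ha with ha | ha <;> rcases hb with hb | hb
      · exact hQc (Finset.mem_sdiff.1 ha).1 (Finset.mem_sdiff.1 hb).1 hab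
      · exact hcross a ha b hb
      · exact (hcross b hb a ha).symm
      · exact hK'c ha hb hab
    · rw [Finset.card_union_of_disjoint]
      · have := Finset.card_sdiff_add_card_inter Q K
        omega
      · rw [Finset.disjoint_left]
        exact fun a ha ha' => (Finset.mem_sdiff.1 ha).2 (hK' ha')
  have hout : ∀ Q ⊆ H, ¬ (Q ∩ K).Nonempty → ∀ z ∈ Q, z ∈ H ∧ z ∉ K := by
    intro Q hQ hne z hz
    exact ⟨hQ hz, fun hzK => hne ⟨z, Finset.mem_inter.2 ⟨hz, hzK⟩⟩⟩
  by_cases hdis : ∃ k ∈ K', k ∈ A'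
  · obtain ⟨k, hkK', hkA'⟩ := hdis
    have hkK := hK' hkK'
    have hp : Perf G ((A' \ K) ∪ L) := by
      refine Perf.substitute (k := k) (hA'p.mono ?_) hLp ?_
      · exact Finset.insert_subset hkA' Finset.sdiff_subset
      · intro l hl p hp
        obtain ⟨hpA', hpK⟩ := Finset.mem_sdiff.1 hp
        rcases hom p (hH'sub (hA' hpA')) hpK with h1 | h1
        · exact iff_of_true (h1 l (hL hl)).symm (h1 k hkK).symm
        · exact iff_of_false (fun hh => h1 l (hL hl) hh.symm) (fun hh => h1 k hkK hh.symm)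
    refine h.1 ⟨(A' \ K) ∪ L, ?_, hp, ?_⟩
    · exact Finset.union_subset (Finset.sdiff_subset.trans (hA'.trans hH'sub))
        (hL.trans hK.subset)
    · obtain ⟨Q, hQ, hQc, hQk⟩ := exists_om G (H \ ((A' \ K) ∪ L))
      have hQ' : ∀ z ∈ Q, z ∈ H ∧ ¬ (z ∈ A' ∧ z ∉ K) ∧ z ∉ L := fun z hz => by
        have := hQ hz
        rw [Finset.mem_sdiff, Finset.mem_union, Finset.mem_sdiff] at this
        tauto
      have hQH : Q ⊆ H := fun z hz => (hQ' z hz).1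
      rw [← hQk]
      by_cases hne : (Q ∩ K).Nonempty
      · obtain ⟨h1, h2⟩ := hrep Q hQH hQc hne
        have h3 := le_om (S := (H \ K) ∪ K')
          (Finset.union_subset_union_left (Finset.sdiff_subset_sdiff hQH subset_rfl)) h1
        have h4 : (Q ∩ K).card ≤ om G (K \ L) := by
          refine le_om (fun z hz => ?_) (hQc.subset (by simp))
          obtain ⟨hzQ, hzK⟩ := Finset.mem_inter.1 hz
          exact Finset.mem_sdiff.2 ⟨hzK, (hQ' z hzQ).2.2⟩
        omega
      · have h3 : Q.card ≤ om G (((H \ K) ∪ K') \ A') := by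
          refine le_om (fun z hz => ?_) hQc
          have h4 := hout Q hQH hne z hz
          have h5 := hQ' z hz
          simp only [Finset.mem_sdiff, Finset.mem_union]
          tauto
        omega
  · push Not at hdis
    refine h.1 ⟨A', hA'.trans hH'sub, hA'p, ?_⟩
    obtain ⟨Q, hQ, hQc, hQk⟩ := exists_om G (H \ A')
    have hQH : Q ⊆ H := hQ.trans Finset.sdiff_subset
    rw [← hQk]
    by_cases hne : (Q ∩ K).Nonempty
    · obtain ⟨h1, h2⟩ := hrep Q hQH hQc hne
      have h3 := le_om (S := ((H \ K) ∪ K') \ A') (fun z hz => ?_) h1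
      · have h4 : (Q ∩ K).card ≤ om G K :=
          le_om Finset.inter_subset_right (hQc.subset (by simp))
        omega
      · have h4 := hdis z
        have h5 := @hQ z
        simp only [Finset.mem_sdiff, Finset.mem_union] at hz h5 ⊢
        tauto
    · have h3 : Q.card ≤ om G (((H \ K) ∪ K') \ A') := by
        refine le_om (fun z hz => ?_) hQc
        have h4 := hout Q hQH hne z hz
        have h5 := (Finset.mem_sdiff.1 (hQ hz)).2
        simp only [Finset.mem_sdiff, Finset.mem_union]
        tauto
      omega

/-- The non-neighbourhood of a vertex of a smallest obstruction is imperfect. -/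
theorem exists_minImp_nonneighbours (h : MinBad G H) {v : V} (hv : v ∈ H) :
    ∃ T ⊆ H, MinImp G T ∧ v ∉ T ∧ ∀ t ∈ T, ¬ G.Adj v t := by
  have hnp : ¬ Perf G (H.filter fun z => ¬ G.Adj v z) := by
    intro hp
    refine h.1 ⟨_, Finset.filter_subset _ _, hp, ?_⟩
    obtain ⟨Q, hQ, hQc, hQk⟩ := exists_om G (H \ H.filter fun z => ¬ G.Adj v z)
    have hQ' : ∀ z ∈ Q, z ∈ H ∧ G.Adj v z := fun z hz => by
      have := hQ hz
      simp only [Finset.mem_sdiff, Finset.mem_filter] at this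
      tauto
    have hvQ : v ∉ Q := fun hh => G.irrefl (hQ' v hh).2
    rw [← hQk, Nat.lt_iff_add_one_le, ← Finset.card_insert_of_notMem hvQ]
    apply le_om
    · exact Finset.insert_subset hv fun z hz => (hQ' z hz).1
    · rw [Finset.coe_insert, SimpleGraph.isClique_insert]
      exact ⟨hQc, fun b hb _ => (hQ' b hb).2⟩
  obtain ⟨T, hT, hm⟩ := exists_minImp hnp
  have hT' : ∀ t ∈ T, t ∈ H ∧ ¬ G.Adj v t := fun t ht => by simpa using hT ht
  refine ⟨T, fun t ht => (hT' t ht).1, hm, fun hvT => ?_, fun t ht => (hT' t ht).2⟩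
  obtain ⟨x, hx, hvx⟩ := hm.exists_adj hvT
  exact (hT' x hx).2 hvx

end MinBad

theorem MinImp.not_isClique {T : Finset V} (h : MinImp G T) : ¬ G.IsClique (T : Set V) := by
  intro hc
  obtain ⟨t, ht⟩ := h.nonempty
  obtain ⟨x, hx, htx⟩ := h.exists_adj ht
  refine h.not_join (A := {t}) ?_ ⟨t, Finset.mem_singleton_self t⟩ ?_
  · refine Finset.ssubset_iff_subset_ne.2 ⟨by simpa using ht, ?_⟩
    rintro rfl
    exact htx.ne (Finset.mem_singleton.1 hx).symm
  · rintro a ha b hb hba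
    rw [Finset.mem_singleton] at ha hba
    subst ha
    exact hc ht hb (Ne.symm hba)

namespace MinBad

variable {H T : Finset V}

/-- A minimally imperfect set avoided by some nonneighbour has a mixed vertex with a private
neighbour. -/
theorem exists_mixed (h : MinBad G H) (hf : ForkFree G) (hT : T ⊆ H) (hm : MinImp G T) {v : V}
    (hv : v ∈ H) (hvT : v ∉ T) (hvn : ∀ t ∈ T, ¬ G.Adj v t) :
    ∃ u ∈ H, ∃ w ∈ H, G.Adj u w ∧ (∀ t ∈ T, ¬ G.Adj w t) ∧ u ∉ T ∧ w ∉ T ∧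
      (∃ t ∈ T, G.Adj u t) ∧ ∃ t ∈ T, ¬ G.Adj u t := by
  by_contra hno
  have hpure : ∀ u ∈ H, u ∉ T → ∀ w ∈ H, w ∉ T → G.Adj u w → (∀ t ∈ T, ¬ G.Adj w t) →
      (∀ t ∈ T, G.Adj u t) ∨ ∀ t ∈ T, ¬ G.Adj u t := by
    intro u hu huT w hw hwT huw hwn
    by_contra! hmix
    exact hno ⟨u, hu, w, hw, huw, hwn, huT, hwT, hmix.2, hmix.1⟩
  let O : V → Prop := fun z => z ∈ H ∧ z ∉ T ∧ ∀ t ∈ T, ¬ G.Adj z t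
  let P : V → Prop := fun z => z ∈ H ∧ z ∉ T ∧ (∀ t ∈ T, G.Adj z t) ∧ ∃ o, O o ∧ G.Adj z o
  let S : V → Prop := fun z => z ∈ H ∧ ¬ O z ∧ ¬ P z
  have hTS : ∀ t ∈ T, S t := fun t ht => ⟨hT ht, fun hh => hh.2.1 ht, fun hh => hh.2.1 ht⟩
  have hSO : ∀ s o, S s → O o → ¬ G.Adj s o := by
    intro s o hs ho hso
    by_cases hsT : s ∈ T
    · exact ho.2.2 s hsT hso.symm
    · rcases hpure s hs.1 hsT o ho.1 ho.2.1 hso ho.2.2 with h1 | h1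
      · exact hs.2.2 ⟨hs.1, hsT, h1, o, ho, hso⟩
      · exact hs.2.1 ⟨hs.1, hsT, h1⟩
  have hU : ∀ p, P p → ∀ a b s, S a → S b → S s → G.Adj p a → G.Adj p b → ¬ G.Adj p s →
      a ≠ b → ¬ G.Adj a b → G.Adj s a → G.Adj s b := by
    rintro p ⟨-, -, -, o, ho, hpo⟩ a b s ha hb hs hpa hpb hps hab hnab hsa
    by_contra hsb
    refine fork_elim hf hpo hpb hpa hsa.symm (fun hh => hSO b o hb ho hh.symm) ?_
      (fun hh => hSO a o ha ho hh.symm) (fun hh => hnab hh.symm)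
      (fun hh => hSO s o hs ho hh.symm) (fun hh => hsb hh.symm) hps
    rintro rfl
    exact hb.2.1 ho
  have hSA : ∀ p, P p → ∀ s, S s → ¬ G.Adj p s → ∀ t ∈ T, G.Adj s t := by
    intro p hp s hs hps
    have hsT : s ∉ T := fun hsT => hps (hp.2.2.1 s hsT)
    have hex : ∃ t ∈ T, G.Adj s t := by
      by_contra! hh
      exact hs.2.1 ⟨hs.1, hsT, hh⟩
    obtain ⟨t, ht, hst⟩ := hex
    by_contra! hh
    obtain ⟨t', ht', hst'⟩ := hh
    refine hm.not_join (A := T.filter fun t => G.Adj s t) ?_ ⟨t, by simp [*]⟩ ?_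
    · exact Finset.filter_ssubset.2 ⟨t', ht', hst'⟩
    · intro a ha b hb hba
      rw [Finset.mem_filter] at ha hba
      by_contra hnab
      exact hba ⟨hb, hU p hp a b s (hTS a ha.1) (hTS b hb) hs (hp.2.2.1 a ha.1) (hp.2.2.1 b hb)
        hps (by rintro rfl; exact hba ha) hnab ha.2⟩
  let r : V → V → Prop := fun a b => S b ∧ ¬ G.Adj a b
  have hK : ∀ t ∈ T, ∀ k, Relation.ReflTransGen r t k → S k ∧ ∀ p, P p → G.Adj p k ∧
      ∀ s, S s → ¬ G.Adj p s → G.Adj s k := by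
    intro t ht k hk
    induction hk with
    | refl =>
      exact ⟨hTS t ht, fun p hp => ⟨hp.2.2.1 t ht, fun s hs hps => hSA p hp s hs hps t ht⟩⟩
    | @tail k l _ hkl ih =>
      refine ⟨hkl.1, fun p hp => ?_⟩
      obtain ⟨ih1, ih2⟩ := ih.2 p hp
      have hpl : G.Adj p l := by
        by_contra hpl
        exact hkl.2 (ih2 l hkl.1 hpl).symm
      refine ⟨hpl, fun s hs hps => ?_⟩
      by_cases he : k = l
      · exact he ▸ ih2 s hs hps
      · exact hU p hp k l s ih.1 hkl.1 hs ih1 hpl hps he hkl.2 (ih2 s hs hps)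
  have hmem : ∀ k, k ∈ (H.filter fun k => ∃ t ∈ T, Relation.ReflTransGen r t k) ↔
      k ∈ H ∧ ∃ t ∈ T, Relation.ReflTransGen r t k := fun k => Finset.mem_filter
  refine h.not_homogeneous (K := H.filter fun k => ∃ t ∈ T, Relation.ReflTransGen r t k) ?_ ?_ ?_
  · refine Finset.filter_ssubset.2 ⟨v, hv, ?_⟩
    rintro ⟨t, ht, htv⟩
    exact (hK t ht v htv).1.2.1 ⟨hv, hvT, hvn⟩
  · intro hc
    refine hm.not_isClique (hc.subset fun t ht => ?_)
    exact Finset.mem_coe.2 ((hmem t).2 ⟨hT ht, t, ht, .refl⟩)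
  · intro z hz hzK
    by_cases hzO : O z
    · refine .inr fun k hk hzk => ?_
      obtain ⟨-, t, ht, htk⟩ := (hmem k).1 hk
      exact hSO k z (hK t ht k htk).1 hzO hzk.symm
    by_cases hzP : P z
    · refine .inl fun k hk => ?_
      obtain ⟨-, t, ht, htk⟩ := (hmem k).1 hk
      exact ((hK t ht k htk).2 z hzP).1
    · refine .inl fun k hk => ?_
      obtain ⟨-, t, ht, htk⟩ := (hmem k).1 hk
      by_contra hzk
      exact hzK ((hmem z).2 ⟨hz, t, ht, htk.tail ⟨⟨hz, hzO, hzP⟩, fun hh => hzk hh.symm⟩⟩)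

/-- Every vertex of a smallest obstruction is anticomplete to an odd hole, to which some vertex
with a private neighbour is attached. -/
theorem exists_hole (h : MinBad G H) (hf : ForkFree G) {v : V} (hv : v ∈ H) :
    ∃ d : ℤ → V, IsHole G d ∧ (∀ k, d k ∈ H ∧ d k ≠ v ∧ ¬ G.Adj v (d k)) ∧
      ∃ u ∈ H, ∃ w ∈ H, G.Adj u w ∧ (∀ k, ¬ G.Adj w (d k)) ∧ ∃ k, G.Adj u (d k) := by
  obtain ⟨T, hT, hm, hvT, hvn⟩ := h.exists_minImp_nonneighbours hv
  obtain ⟨u, hu, w, hw, huw, hwn, huT, hwT, ⟨x, hx, hux⟩, ⟨y, hy, huy⟩⟩ :=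
    h.exists_mixed hf hT hm hv hvT hvn
  have hmem : ∀ z, z ∈ (T.filter fun t => G.Adj u t) ↔ z ∈ T ∧ G.Adj u z :=
    fun z => Finset.mem_filter
  have hclique : G.IsClique ((T.filter fun t => G.Adj u t : Finset V) : Set V) := by
    by_contra hnc
    obtain ⟨a, ha, b, hb, hab, hnab⟩ : ∃ a, (a ∈ T ∧ G.Adj u a) ∧ ∃ b, (b ∈ T ∧ G.Adj u b) ∧
        a ≠ b ∧ ¬ G.Adj a b := by
      by_contra! hh
      exact hnc fun a ha b hb hab => hh a ((hmem a).1 ha) b ((hmem b).1 hb) hab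
    let r : V → V → Prop := fun k l => G.Adj u k ∧ (l ∈ T ∧ G.Adj u l) ∧ ¬ G.Adj k l
    have hr : ∀ k l z, k ∈ T → r k l → z ∈ T → ¬ G.Adj u z → G.Adj z k → G.Adj z l := by
      intro k l z hk hkl hz huz hzk
      by_contra hzl
      refine fork_elim hf huw hkl.2.1.2 hkl.1 hzk.symm (hwn l hkl.2.1.1) ?_ (hwn k hk)
        (fun hh => hkl.2.2 hh.symm) (hwn z hz) (fun hh => hzl hh.symm) huz
      rintro rfl
      exact hwT hkl.2.1.1
    have hKX : ∀ k, Relation.ReflTransGen r a k → k ∈ T ∧ G.Adj u k := by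
      intro k hk
      rcases hk.cases_tail with rfl | ⟨l, -, hl⟩
      · exact ha
      · exact hl.2.1
    have hmem' : ∀ k, k ∈ (T.filter fun k => Relation.ReflTransGen r a k) ↔
        k ∈ T ∧ Relation.ReflTransGen r a k := fun k => Finset.mem_filter
    have hb' : Relation.ReflTransGen r a b := .single ⟨ha.2, hb, hnab⟩
    refine hm.not_homogeneous (K := T.filter fun k => Relation.ReflTransGen r a k)
      ?_ ?_ fun z hz hzK => ?_
    · exact Finset.filter_ssubset.2 ⟨y, hy, fun hh => huy (hKX y hh).2⟩
    · exact Finset.one_lt_card.2 ⟨a, (hmem' a).2 ⟨ha.1, .refl⟩, b, (hmem' b).2 ⟨hb.1, hb'⟩, hab⟩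
    · by_cases huz : G.Adj u z
      · refine .inl fun k hk => ?_
        obtain ⟨hkT, hk⟩ := (hmem' k).1 hk
        by_contra hzk
        exact hzK ((hmem' z).2 ⟨hz, hk.tail ⟨(hKX k hk).2, ⟨hz, huz⟩, fun hh => hzk hh.symm⟩⟩)
      · have hiff : ∀ k, Relation.ReflTransGen r a k → (G.Adj z a ↔ G.Adj z k) := by
          intro k hk
          induction hk with
          | refl => rfl
          | @tail k l hk hkl ih =>
            refine ih.trans ⟨hr k l z (hKX k hk).1 hkl hz huz, ?_⟩
            exact hr l k z hkl.2.1.1 ⟨hkl.2.1.2, hKX k hk, fun hh => hkl.2.2 hh.symm⟩ hz huz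
        by_cases hza : G.Adj z a
        · exact .inl fun k hk => (hiff k ((hmem' k).1 hk).2).1 hza
        · exact .inr fun k hk hzk => hza ((hiff k ((hmem' k).1 hk).2).2 hzk)
  obtain ⟨n, c, ⟨hn, ho, hc, hcT⟩, i, hi⟩ := hm.exists_oddHole (X := T.filter fun t => G.Adj u t)
    (Finset.filter_subset _ _) hclique ⟨x, by simp [*]⟩ (by
      intro x hx y hy z hz hyX hzX hxy hxz hyz
      rw [hmem] at hx hyX hzX
      by_contra hnyz
      exact fork_elim hf hxy hxz hx.2.symm huw hnyz hyz (fun hh => hyX ⟨hy, hh.symm⟩)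
        (fun hh => hzX ⟨hz, hh.symm⟩) (fun hh => hwn y hy hh.symm) (fun hh => hwn z hz hh.symm)
        (fun hh => hwn x hx.1 hh.symm))
  have : NeZero n := ⟨by omega⟩
  refine ⟨fun k => c k, ⟨n, c, hn, ho, hc, fun k => rfl⟩, fun k => ⟨hT (hcT _), ?_, hvn _ (hcT _)⟩,
    u, hu, w, hw, huw, fun k => hwn _ (hcT _), i.val, ?_⟩
  · intro he
    exact hvT (he ▸ hcT _)
  · have := ((hmem _).1 hi).2
    simpa using this

end MinBad

/-- A vertex `u` attached to two consecutive vertices of an odd hole, with a private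
neighbour `w`. -/
structure Balloon (G : SimpleGraph V) (d : ℤ → V) (u w : V) : Prop where
  hole : IsHole G d
  adj : G.Adj u w
  private_nbr : ∀ k, ¬ G.Adj w (d k)
  adj_iff : ∀ k, G.Adj u (d k) ↔ d k = d 0 ∨ d k = d 1

/-- The neighbours of `u` outside the closed neighbourhood of `w`. -/
def Far (G : SimpleGraph V) (u w r : V) : Prop :=
  G.Adj u r ∧ ¬ G.Adj w r ∧ w ≠ r

namespace Balloon

variable {d : ℤ → V} {u w : V}

theorem symm (h : Balloon G d u w) : Balloon G (fun k => d (1 - k)) u w :=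
  ⟨h.hole.reflect 1, h.adj, fun k => h.private_nbr _, fun k => by
    simpa using (h.adj_iff _).trans or_comm⟩

theorem adj_zero (h : Balloon G d u w) : G.Adj u (d 0) := (h.adj_iff 0).2 (.inl rfl)

theorem adj_one (h : Balloon G d u w) : G.Adj u (d 1) := (h.adj_iff 1).2 (.inr rfl)

theorem not_adj_right (h : Balloon G d u w) {k : ℤ} (h1 : 2 ≤ k) (h2 : k ≤ 4) :
    ¬ G.Adj u (d k) := by
  rw [h.adj_iff]
  rintro (he | he)
  · exact h.hole.ne' (by omega) (by omega) he
  · exact h.hole.ne' (by omega) (by omega) he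

theorem not_adj_left (h : Balloon G d u w) {k : ℤ} (h1 : k ≤ -1) (h2 : -3 ≤ k) :
    ¬ G.Adj u (d k) := by
  rw [h.adj_iff]
  rintro (he | he)
  · exact h.hole.ne (by omega) (by omega) he
  · exact h.hole.ne (by omega) (by omega) he

theorem private_nbr' (h : Balloon G d u w) (k : ℤ) : ¬ G.Adj (d k) w :=
  fun hh => h.private_nbr k hh.symm

theorem ne (h : Balloon G d u w) (k : ℤ) : w ≠ d k := by
  rintro rfl
  exact h.private_nbr (k + 1) (h.hole.adj_succ k)

theorem hole_adj (h : Balloon G d u w) {k l : ℤ} (hkl : l = k + 1) : G.Adj (d k) (d l) :=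
  hkl ▸ h.hole.adj_succ k

theorem adj_neg_one_of_far (h : Balloon G d u w) (hf : ForkFree G) {r : V} (hr : Far G u w r)
    (h0 : ¬ G.Adj r (d 0)) : G.Adj r (d (-1)) := by
  by_contra h1
  exact fork_elim hf h.adj hr.1 h.adj_zero (h.hole_adj (k := -1) (by norm_num)).symm hr.2.1 hr.2.2
    (h.private_nbr _) h0 (h.private_nbr _) h1 (h.not_adj_left (by omega) (by omega))

theorem adj_zero_of_far (h : Balloon G d u w) (hf : ForkFree G) {r : V} (hr : Far G u w r)
    (hr0 : r ≠ d 0) : G.Adj r (d 0) := by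
  by_contra h0
  have hother : ∀ i, G.Adj r (d i) → d i = d 1 ∨ d i = d (-1) := by
    intro i hi
    by_contra! hne
    refine fork_elim hf h.adj h.adj_zero hr.1 hi (h.private_nbr _) (h.ne _) hr.2.1
      (fun hh => h0 hh.symm) (h.private_nbr _) ?_ ?_
    · rw [h.hole.adj_iff]
      simpa using hne
    · rw [h.adj_iff]
      rintro (he | he)
      · exact h0 (he ▸ hi)
      · exact hne.1 he
  have h2 : ¬ G.Adj r (d 2) := fun hh => by
    rcases hother 2 hh with he | he
    · exact h.hole.ne' (by omega) (by omega) he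
    · exact h.hole.ne' (by omega) (by omega) he
  have h3 : ¬ G.Adj r (d 3) := fun hh => by
    rcases hother 3 hh with he | he
    · exact h.hole.ne' (by omega) (by omega) he
    · exact h.hole.ne' (by omega) (by omega) he
  have h1 : G.Adj r (d 1) := by
    by_contra h1
    exact h2 (h.symm.adj_neg_one_of_far hf hr h1)
  exact fork_elim hf (h.hole_adj (k := 0) (by norm_num)).symm h1.symm
    (h.hole_adj (l := 2) (by norm_num)) (h.hole_adj (l := 3) (by norm_num))
    (fun hh => h0 hh.symm) hr0.symm (h.hole.not_adj (by omega) (by omega)) h2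
    (h.hole.not_adj (by omega) (by omega)) h3 (h.hole.not_adj (by omega) (by omega))

theorem adj_one_of_far (h : Balloon G d u w) (hf : ForkFree G) {r : V} (hr : Far G u w r)
    (hr1 : r ≠ d 1) : G.Adj r (d 1) :=
  h.symm.adj_zero_of_far hf hr hr1

theorem far_ne (h : Balloon G d u w) {r : V} (hr : Far G u w r)
    (hr0 : r ≠ d 0) (hr1 : r ≠ d 1) (k : ℤ) : r ≠ d k := by
  rintro rfl
  exact ((h.adj_iff k).1 hr.1).elim hr0 hr1

/-- A vertex distinguishing two nonadjacent far vertices is itself far. -/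
theorem far_of_mixed (h : Balloon G d u w) (hf : ForkFree G) (hp : OddParachuteFree G)
    {a b t : V} (ha : Far G u w a) (ha0 : a ≠ d 0) (ha1 : a ≠ d 1) (hb : Far G u w b)
    (hb0 : b ≠ d 0) (hb1 : b ≠ d 1) (hne : a ≠ b) (hab : ¬ G.Adj a b) (hta : G.Adj t a)
    (htb : ¬ G.Adj t b) : Far G u w t := by
  have hwt : w ≠ t := by
    rintro rfl
    exact ha.2.1 hta
  by_cases htw : G.Adj w t
  swap
  · refine ⟨?_, htw, hwt⟩
    by_contra hut
    exact fork_elim hf h.adj hb.1 ha.1 hta.symm hb.2.1 hb.2.2 ha.2.1 (fun hh => hab hh.symm) htw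
      (fun hh => htb hh.symm) hut
  exfalso
  have hN : ∀ {x y : V}, Far G u w x → Far G u w y → y ≠ d 0 → y ≠ d 1 → x ≠ y → ¬ G.Adj x y →
      ∀ i, G.Adj x (d i) → G.Adj y (d i) := by
    intro x y hx hy hy0 hy1 hxy hnxy i hi
    by_contra hyi
    refine fork_elim hf h.adj hy.1 hx.1 hi hy.2.1 hy.2.2 hx.2.1 (fun hh => hnxy hh.symm)
      (h.private_nbr _) hyi ?_
    rw [h.adj_iff]
    rintro (he | he)
    · exact hyi (he ▸ h.adj_zero_of_far hf hy hy0)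
    · exact hyi (he ▸ h.adj_one_of_far hf hy hy1)
  have hNa := hN ha hb hb0 hb1 hne hab
  have hNb := hN hb ha ha0 ha1 hne.symm fun hh => hab hh.symm
  have hα : ∀ i l, G.Adj a (d i) → G.Adj a (d l) → ¬ G.Adj t (d i) → ¬ G.Adj t (d l) →
      d i ≠ d l → ¬ G.Adj (d i) (d l) → False := by
    intro i l hi hl hti htl hil hnil
    exact fork_elim hf hi hl hta.symm htw.symm hnil hil (fun hh => hti hh.symm)
      (fun hh => htl hh.symm) (h.private_nbr' _) (h.private_nbr' _) fun hh => ha.2.1 hh.symm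
  have hβ : ∀ k l, G.Adj (d k) (d l) → G.Adj a (d k) → G.Adj t (d k) → ¬ G.Adj t (d l) →
      G.Adj a (d l) := by
    intro k l hkl hk htk htl
    by_contra hl
    exact fork_elim hf hkl (hNa k hk).symm htk.symm htw.symm (fun hh => hl (hNb l hh.symm))
      (h.far_ne hb hb0 hb1 l).symm (fun hh => htl hh.symm) (fun hh => htb hh.symm)
      (h.private_nbr' _) (fun hh => hb.2.1 hh.symm) (h.private_nbr' _)
  have hγ : ∀ k l m, G.Adj a (d k) → ¬ G.Adj a (d l) → ¬ G.Adj a (d m) → G.Adj (d k) (d l) →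
      G.Adj (d l) (d m) → ¬ G.Adj (d k) (d m) → False := by
    intro k l m hk hl hm hkl hlm hkm
    exact fork_elim hf hk.symm (hNa k hk).symm hkl hlm hab hne hl (fun hh => hl (hNb l hh)) hm
      (fun hh => hm (hNb m hh)) hkm
  have hole := h.hole
  have n0 := h.adj_zero_of_far hf ha ha0
  have n1 := h.adj_one_of_far hf ha ha1
  by_cases hcom : ∃ i, G.Adj a (d i) ∧ G.Adj t (d i)
  · obtain ⟨i, hai, hti⟩ := hcom
    obtain ⟨j, hj⟩ := hole.attachment hf hp htw.symm h.private_nbr hti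
    have t0 : G.Adj t (d j) := (hj j).2 (.inl rfl)
    have t1 : G.Adj t (d (j + 1)) := (hj (j + 1)).2 (.inr rfl)
    have t2 : ¬ G.Adj t (d (j + 2)) := by
      rw [hj]
      rintro (he | he)
      · exact hole.ne' (by omega) (by omega) he
      · exact hole.ne' (by omega) (by omega) he
    have tm : ¬ G.Adj t (d (j - 1)) := by
      rw [hj]
      rintro (he | he)
      · exact hole.ne (by omega) (by omega) he
      · exact hole.ne (by omega) (by omega) he
    have e0 : G.Adj (d j) (d (j - 1)) := (h.hole_adj (by omega)).symm
    have e1 : G.Adj (d (j + 1)) (d (j + 2)) := h.hole_adj (by omega)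
    have hnot : G.Adj a (d (j - 1)) → ¬ G.Adj a (d (j + 2)) := fun h1 h2 =>
      hα _ _ h1 h2 tm t2 (hole.ne (by omega) (by omega)) (hole.not_adj (by omega) (by omega))
    by_cases a0 : G.Adj a (d j)
    · have am := hβ _ _ e0 a0 t0 tm
      by_cases a1 : G.Adj a (d (j + 1))
      · exact hnot am (hβ _ _ e1 a1 t1 t2)
      · exact hγ _ _ _ a0 a1 (hnot am) (h.hole_adj rfl) e1 (hole.not_adj (by omega) (by omega))
    · have a1 : G.Adj a (d (j + 1)) := by
        rcases (hj i).1 hti with he | he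
        · exact (a0 (he ▸ hai)).elim
        · exact he ▸ hai
      have a2 := hβ _ _ e1 a1 t1 t2
      exact hγ _ _ _ a1 a0 (fun hh => hnot hh a2) (h.hole_adj rfl).symm e0
        (hole.not_adj' (by omega) (by omega))
  · push Not at hcom
    have n2 : ¬ G.Adj a (d 2) := fun n2 =>
      hα 0 2 n0 n2 (hcom 0 n0) (hcom 2 n2) (hole.ne (by omega) (by omega))
        (hole.not_adj (by omega) (by omega))
    have n3 : ¬ G.Adj a (d 3) := fun n3 =>
      hα 1 3 n1 n3 (hcom 1 n1) (hcom 3 n3) (hole.ne (by omega) (by omega))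
        (hole.not_adj (by omega) (by omega))
    exact hγ 1 2 3 n1 n2 n3 (h.hole_adj (by norm_num)) (h.hole_adj (by norm_num))
      (hole.not_adj (by omega) (by omega))

/-- The neighbours of `u` outside the closed neighbourhood of `w` form a clique. -/
theorem far_adj (h : Balloon G d u w) (hf : ForkFree G) (hp : OddParachuteFree G) {H : Finset V}
    (hH : MinBad G H) (hu : u ∈ H) {a b : V} (ha : Far G u w a) (hb : Far G u w b)
    (hne : a ≠ b) : G.Adj a b := by
  by_contra hab
  let r : V → V → Prop := fun k l => Far G u w l ∧ ¬ G.Adj k l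
  have hstep : ∀ k l, Far G u w k → k ≠ l → Far G u w l → ¬ G.Adj k l → k ≠ d 0 ∧ k ≠ d 1 := by
    intro k l hk hkl hl hnkl
    constructor
    · rintro rfl
      exact hnkl (h.adj_zero_of_far hf hl hkl.symm).symm
    · rintro rfl
      exact hnkl (h.adj_one_of_far hf hl hkl.symm).symm
  obtain ⟨ha0, ha1⟩ := hstep a b ha hne hb hab
  have hK : ∀ k, Relation.ReflTransGen r a k → Far G u w k ∧ k ≠ d 0 ∧ k ≠ d 1 := by
    intro k hk
    induction hk with
    | refl => exact ⟨ha, ha0, ha1⟩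
    | @tail k l _ hkl ih =>
      by_cases he : k = l
      · exact he ▸ ih
      · exact ⟨hkl.1, hstep l k hkl.1 (Ne.symm he) ih.1 fun hh => hkl.2 hh.symm⟩
  have hhom : ∀ z, ¬ Relation.ReflTransGen r a z → ∀ k, Relation.ReflTransGen r a k →
      (G.Adj z a ↔ G.Adj z k) := by
    intro z hz k hk
    by_cases hzf : Far G u w z
    · have : ∀ k, Relation.ReflTransGen r a k → G.Adj z k := fun k hk => by
        by_contra hzk
        exact hz (hk.tail ⟨hzf, fun hh => hzk hh.symm⟩)
      exact iff_of_true (this a .refl) (this k hk)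
    · induction hk with
      | refl => rfl
      | @tail k l hk hkl ih =>
        by_cases he : k = l
        · exact he ▸ ih
        obtain ⟨k1, k2, k3⟩ := hK k hk
        obtain ⟨l1, l2, l3⟩ := hK l (hk.tail hkl)
        refine ih.trans ⟨fun hzk => ?_, fun hzl => ?_⟩
        · by_contra hzl
          exact hzf (h.far_of_mixed hf hp k1 k2 k3 l1 l2 l3 he hkl.2 hzk hzl)
        · by_contra hzk
          exact hzf (h.far_of_mixed hf hp l1 l2 l3 k1 k2 k3 (Ne.symm he)
            (fun hh => hkl.2 hh.symm) hzl hzk)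
  have hbK : Relation.ReflTransGen r a b := .single ⟨hb, hab⟩
  obtain ⟨e, he, heu, -⟩ := hH.exists_hole hf hu
  have heK : ∀ k, ¬ Relation.ReflTransGen r a (e k) := fun k hk => (heu k).2.2 (hK _ hk).1.1
  by_cases hae : ∃ k, G.Adj a (e k)
  · obtain ⟨k, hk⟩ := hae
    obtain ⟨j, hj⟩ := he.attachment hf hp ha.1.symm (fun k => (heu k).2.2) hk
    have hiff : ∀ i, G.Adj a (e i) ↔ G.Adj b (e i) := fun i => by
      simpa [G.adj_comm] using hhom (e i) (heK i) b hbK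
    have a1 : G.Adj a (e (j + 1)) := (hj _).2 (.inr rfl)
    have a2 : ¬ G.Adj a (e (j + 2)) := by
      rw [hj]
      rintro (hh | hh)
      · exact he.ne' (by omega) (by omega) hh
      · exact he.ne' (by omega) (by omega) hh
    have a3 : ¬ G.Adj a (e (j + 3)) := by
      rw [hj]
      rintro (hh | hh)
      · exact he.ne' (by omega) (by omega) hh
      · exact he.ne' (by omega) (by omega) hh
    have e12 := he.adj_succ (j + 1)
    have e23 := he.adj_succ (j + 2)
    rw [add_assoc] at e12 e23
    exact fork_elim hf a1.symm ((hiff _).1 a1).symm e12 e23 hab hne a2 (mt (hiff _).2 a2) a3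
      (mt (hiff _).2 a3) (he.not_adj (by omega) (by omega))
  · push Not at hae
    let s : V → V → Prop := fun p q =>
      (¬ Relation.ReflTransGen r a q ∧ ¬ G.Adj a q) ∧ G.Adj p q
    have hJ : ∀ z, Relation.ReflTransGen s (e 0) z →
        ¬ Relation.ReflTransGen r a z ∧ ¬ G.Adj a z := by
      intro z hz
      rcases hz.cases_tail with rfl | ⟨y, -, hy⟩
      · exact ⟨heK 0, hae 0⟩
      · exact hy.1
    have hJb : ∀ z, Relation.ReflTransGen s (e 0) z → ∀ k, Relation.ReflTransGen r a k →
        ¬ G.Adj k z := fun z hz k hk hkz =>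
      (hJ z hz).2 ((hhom z (hJ z hz).1 k hk).2 hkz.symm).symm
    have hpre : ∀ z y, ¬ Relation.ReflTransGen s (e 0) z → Relation.ReflTransGen s (e 0) y →
        G.Adj z y → ¬ Relation.ReflTransGen r a z ∧ G.Adj z a := by
      intro z y hz hy hzy
      have hzK : ¬ Relation.ReflTransGen r a z := fun hzK => hJb y hy z hzK hzy
      refine ⟨hzK, ?_⟩
      by_contra hza
      exact hz (hy.tail ⟨⟨hzK, fun hh => hza hh.symm⟩, hzy.symm⟩)
    have hedge : ∀ z y y', ¬ Relation.ReflTransGen s (e 0) z → Relation.ReflTransGen s (e 0) y →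
        Relation.ReflTransGen s (e 0) y' → G.Adj y y' → G.Adj z y → G.Adj z y' := by
      intro z y y' hz hy hy' hyy hzy
      obtain ⟨hzK, hza⟩ := hpre z y hz hy hzy
      by_contra hzy'
      exact fork_elim hf hza ((hhom z hzK b hbK).1 hza) hzy hyy hab hne (hJ y hy).2
        (hJb y hy b hbK) (hJ y' hy').2 (hJb y' hy' b hbK) hzy'
    have hiff : ∀ z y, ¬ Relation.ReflTransGen s (e 0) z → Relation.ReflTransGen s (e 0) y →
        (G.Adj z (e 0) ↔ G.Adj z y) := by
      intro z y hz hy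
      induction hy with
      | refl => rfl
      | @tail y y' hy hyy ih =>
        have hy' := hy.tail hyy
        exact ih.trans ⟨hedge z y y' hz hy hy' hyy.2, hedge z y' y hz hy' hy hyy.2.symm⟩
    have hmem : ∀ z, z ∈ (H.filter fun z => Relation.ReflTransGen s (e 0) z) ↔
        z ∈ H ∧ Relation.ReflTransGen s (e 0) z := fun z => Finset.mem_filter
    have hJ1 : Relation.ReflTransGen s (e 0) (e 1) :=
      .single ⟨⟨heK 1, hae 1⟩, he.adj_succ 0⟩
    have hJ2 : Relation.ReflTransGen s (e 0) (e 2) :=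
      hJ1.tail ⟨⟨heK 2, hae 2⟩, he.adj_succ 1⟩
    refine hH.not_homogeneous (K := H.filter fun z => Relation.ReflTransGen s (e 0) z) ?_ ?_ ?_
    · exact Finset.filter_ssubset.2 ⟨u, hu, fun hh => (hJ u hh).2 ha.1.symm⟩
    · intro hc
      exact he.not_adj (k := 0) (l := 2) (by omega) (by omega)
        (hc ((hmem _).2 ⟨(heu 0).1, .refl⟩) ((hmem _).2 ⟨(heu 2).1, hJ2⟩)
          (he.ne (by omega) (by omega)))
    · intro z hz hzJ
      have hzJ' : ¬ Relation.ReflTransGen s (e 0) z := fun hh => hzJ ((hmem z).2 ⟨hz, hh⟩)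
      by_cases hz0 : G.Adj z (e 0)
      · exact .inl fun k hk => (hiff z k hzJ' ((hmem k).1 hk).2).1 hz0
      · exact .inr fun k hk hzk => hz0 ((hiff z k hzJ' ((hmem k).1 hk).2).2 hzk)

theorem eq_of_adj_three (h : Balloon G d u w) (hf : ForkFree G) (hp : OddParachuteFree G)
    {z : V} (hzw : G.Adj z w) {i j k : ℤ} (hi : G.Adj z (d i)) (hj : G.Adj z (d j))
    (hk : G.Adj z (d k)) : d i = d j ∨ d i = d k ∨ d j = d k := by
  obtain ⟨m, hm⟩ := h.hole.attachment hf hp hzw h.private_nbr hi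
  rw [hm] at hi hj hk
  grind

theorem not_adj_of_near (h : Balloon G d u w) (hf : ForkFree G) (hp : OddParachuteFree G)
    {z : V} (hzw : G.Adj z w) {i j k : ℤ} (hi : G.Adj z (d i)) (hj : G.Adj z (d j))
    (hij : d i ≠ d j) (hik : d i ≠ d k) (hjk : d j ≠ d k) : ¬ G.Adj z (d k) := fun hk => by
  rcases h.eq_of_adj_three hf hp hzw hi hj hk with he | he | he
  · exact hij he
  · exact hik he
  · exact hjk he

theorem adj_succ_or_pred (h : Balloon G d u w) (hf : ForkFree G) (hp : OddParachuteFree G)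
    {z : V} (hzw : G.Adj z w) {i : ℤ} (hi : G.Adj z (d i)) :
    G.Adj z (d (i + 1)) ∨ G.Adj z (d (i - 1)) := by
  obtain ⟨m, hm⟩ := h.hole.attachment hf hp hzw h.private_nbr hi
  rcases (hm i).1 hi with he | he
  · exact .inl ((hm _).2 (.inr (h.hole.add_congr he 1)))
  · refine .inr ((hm _).2 (.inl ?_))
    have := h.hole.add_congr he (-1)
    simpa [← sub_eq_add_neg] using this

/-- Common neighbours of `u`, `w` and the attachment of `u` are adjacent. -/
theorem centre_adj (h : Balloon G d u w) (hf : ForkFree G) (hp : OddParachuteFree G) {y z : V}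
    (hyw : G.Adj y w) (hzw : G.Adj z w) (hy0 : G.Adj y (d 0)) (hy1 : G.Adj y (d 1))
    (hz0 : G.Adj z (d 0)) (hz1 : G.Adj z (d 1)) (hyz : y ≠ z) : G.Adj y z := by
  by_contra hn
  have key : ∀ {x}, G.Adj x w → G.Adj x (d 0) → G.Adj x (d 1) →
      ¬ G.Adj x (d 2) ∧ ¬ G.Adj x (d 3) := fun hx h0 h1 =>
    ⟨h.not_adj_of_near hf hp hx h0 h1 (h.hole.ne (by omega) (by omega))
      (h.hole.ne (by omega) (by omega)) (h.hole.ne (by omega) (by omega)),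
    h.not_adj_of_near hf hp hx h0 h1 (h.hole.ne (by omega) (by omega))
      (h.hole.ne (by omega) (by omega)) (h.hole.ne (by omega) (by omega))⟩
  exact fork_elim hf hy1.symm hz1.symm (h.hole_adj (k := 1) (l := 2) (by norm_num))
    (h.hole_adj (k := 2) (l := 3) (by norm_num)) hn hyz (key hyw hy0 hy1).1 (key hzw hz0 hz1).1
    (key hyw hy0 hy1).2 (key hzw hz0 hz1).2 (h.hole.not_adj (by omega) (by omega))

theorem adj_two_of_far (h : Balloon G d u w) (hf : ForkFree G) (hp : OddParachuteFree G)
    {f r : V} (hfw : G.Adj f w) (hf0 : G.Adj f (d 0)) (hf1 : G.Adj f (d 1)) (hr : Far G u w r)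
    (hr1 : r ≠ d 1) (hfr : ¬ G.Adj f r) : G.Adj r (d 2) := by
  by_contra hn
  refine fork_elim hf (h.hole_adj (k := 1) (l := 2) (by norm_num))
    (h.adj_one_of_far hf hr hr1).symm hf1.symm hfw (fun hh => hn hh.symm) ?_ (fun hh => ?_)
    (fun hh => hfr hh.symm) (h.private_nbr' _) (fun hh => hr.2.1 hh.symm) (h.private_nbr' _)
  · rintro rfl
    exact h.not_adj_right (by omega) (by omega) hr.1
  · exact h.not_adj_of_near hf hp hfw hf0 hf1 (h.hole.ne (by omega) (by omega))
      (h.hole.ne (by omega) (by omega)) (h.hole.ne (by omega) (by omega)) hh.symm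

theorem centre_adj_far (h : Balloon G d u w) (hf : ForkFree G) (hp : OddParachuteFree G)
    {f r : V} (hfw : G.Adj f w) (hf0 : G.Adj f (d 0)) (hf1 : G.Adj f (d 1))
    (hr : Far G u w r) : G.Adj f r := by
  by_contra hn
  have hr0 : r ≠ d 0 := fun he => hn (he ▸ hf0)
  have hr1 : r ≠ d 1 := fun he => hn (he ▸ hf1)
  have h2 := h.adj_two_of_far hf hp hfw hf0 hf1 hr hr1 hn
  have hm : G.Adj r (d (-1)) := h.symm.adj_two_of_far hf hp hfw hf1 hf0 hr hr0 hn
  exact fork_elim hf hm h2 hr.1.symm h.adj (h.hole.not_adj (by omega) (by omega))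
    (h.hole.ne (by omega) (by omega)) (fun hh => h.not_adj_left (by omega) (by omega) hh.symm)
    (fun hh => h.not_adj_right (by omega) (by omega) hh.symm) (h.private_nbr' _)
    (h.private_nbr' _) fun hh => hr.2.1 hh.symm

theorem adj_of_adj_two (h : Balloon G d u w) (hf : ForkFree G) (hp : OddParachuteFree G)
    {y z : V} (huy : G.Adj u y) (huz : G.Adj u z) (hyw : G.Adj y w) (hzw : G.Adj z w)
    (hy1 : ¬ G.Adj y (d 1)) (hz1 : ¬ G.Adj z (d 1)) (hz2 : G.Adj z (d 2)) (hyz : y ≠ z) :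
    G.Adj y z := by
  by_contra hn
  have hz3 : G.Adj z (d 3) := (h.adj_succ_or_pred hf hp hzw hz2).resolve_right hz1
  have hz0 : ¬ G.Adj z (d 0) := h.not_adj_of_near hf hp hzw hz2 hz3
    (h.hole.ne (by omega) (by omega)) (h.hole.ne' (by omega) (by omega))
    (h.hole.ne' (by omega) (by omega))
  have hzm : ¬ G.Adj z (d (-1)) := h.not_adj_of_near hf hp hzw hz2 hz3
    (h.hole.ne (by omega) (by omega)) (h.hole.ne' (by omega) (by omega))
    (h.hole.ne' (by omega) (by omega))
  have um := h.not_adj_left (k := -1) (by omega) (by omega)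
  have h0m : G.Adj (d 0) (d (-1)) := (h.hole_adj (by norm_num)).symm
  by_cases hy0 : G.Adj y (d 0)
  · have hym : G.Adj y (d (-1)) := (h.adj_succ_or_pred hf hp hyw hy0).resolve_left hy1
    refine fork_elim hf h.adj_one huy huz hz3 (fun hh => hy1 hh.symm) ?_ (fun hh => hz1 hh.symm)
      hn (h.hole.not_adj (by omega) (by omega)) ?_ (h.not_adj_right (by omega) (by omega))
    · rintro rfl
      exact h.private_nbr' _ hyw
    · exact h.not_adj_of_near hf hp hyw hy0 hym (h.hole.ne' (by omega) (by omega))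
        (h.hole.ne (by omega) (by omega)) (h.hole.ne (by omega) (by omega))
  by_cases hym : G.Adj y (d (-1))
  · have hym2 : G.Adj y (d (-2)) := (h.adj_succ_or_pred hf hp hyw hym).resolve_left hy0
    refine fork_elim hf huy h.adj_zero huz hz2 hy0 ?_ hn (fun hh => hz0 hh.symm) ?_
      (h.hole.not_adj (by omega) (by omega)) (h.not_adj_right (by omega) (by omega))
    · rintro rfl
      exact h.private_nbr' _ hyw
    · exact h.not_adj_of_near hf hp hyw hym hym2 (h.hole.ne' (by omega) (by omega))
        (h.hole.ne (by omega) (by omega)) (h.hole.ne (by omega) (by omega))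
  exact fork_elim hf huy huz h.adj_zero h0m hn hyz hy0 hz0 hym hzm um

theorem adj_of_not_adj_one (h : Balloon G d u w) (hf : ForkFree G) (hp : OddParachuteFree G)
    {y z : V} (huy : G.Adj u y) (huz : G.Adj u z) (hyw : G.Adj y w) (hzw : G.Adj z w)
    (hy1 : ¬ G.Adj y (d 1)) (hz1 : ¬ G.Adj z (d 1)) (hyz : y ≠ z) : G.Adj y z := by
  by_contra hn
  by_cases hz2 : G.Adj z (d 2)
  · exact hn (h.adj_of_adj_two hf hp huy huz hyw hzw hy1 hz1 hz2 hyz)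
  by_cases hy2 : G.Adj y (d 2)
  · exact hn (h.adj_of_adj_two hf hp huz huy hzw hyw hz1 hy1 hy2 hyz.symm).symm
  exact fork_elim hf huy huz h.adj_one (h.hole_adj (l := 2) (by norm_num)) hn hyz hy1 hz1 hy2 hz2
    (h.not_adj_right (by omega) (by omega))

theorem adj_of_adj_one (h : Balloon G d u w) (hf : ForkFree G) (hp : OddParachuteFree G)
    {y z : V} (huy : G.Adj u y) (huz : G.Adj u z) (hyw : G.Adj y w) (hzw : G.Adj z w)
    (hy1 : G.Adj y (d 1)) (hy0 : ¬ G.Adj y (d 0)) (hz1 : G.Adj z (d 1)) (hz0 : ¬ G.Adj z (d 0))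
    (hyz : y ≠ z) : G.Adj y z := by
  by_contra hn
  have key : ∀ {x}, G.Adj x w → G.Adj x (d 1) → ¬ G.Adj x (d 0) → ¬ G.Adj x (d (-1)) := by
    intro x hx h1 h0
    have h2 : G.Adj x (d 2) := (h.adj_succ_or_pred hf hp hx h1).resolve_right h0
    exact h.not_adj_of_near hf hp hx h1 h2 (h.hole.ne (by omega) (by omega))
      (h.hole.ne' (by omega) (by omega)) (h.hole.ne' (by omega) (by omega))
  exact fork_elim hf huy huz h.adj_zero (h.hole_adj (k := -1) (by norm_num)).symm hn hyz hy0 hz0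
    (key hyw hy1 hy0) (key hzw hz1 hz0) (h.not_adj_left (by omega) (by omega))

theorem trisimplicial (h : Balloon G d u w) (hf : ForkFree G) (hp : OddParachuteFree G)
    {H : Finset V} (hH : MinBad G H) (hu : u ∈ H) : Trisimplicial G u := by
  refine ⟨{z | G.Adj u z ∧ ((¬ G.Adj z w ∧ w ≠ z) ∨
        (G.Adj z w ∧ G.Adj z (d 0) ∧ G.Adj z (d 1)))},
    {z | G.Adj u z ∧ (w = z ∨ (G.Adj z w ∧ ¬ G.Adj z (d 1)))},
    {z | G.Adj u z ∧ G.Adj z w ∧ G.Adj z (d 1) ∧ ¬ G.Adj z (d 0)}, ?_, ?_, ?_, ?_⟩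
  · rintro y ⟨huy, hy | ⟨hyw, hy0, hy1⟩⟩ z ⟨huz, hz | ⟨hzw, hz0, hz1⟩⟩ hyz
    · exact h.far_adj hf hp hH hu ⟨huy, fun hh => hy.1 hh.symm, hy.2⟩
        ⟨huz, fun hh => hz.1 hh.symm, hz.2⟩ hyz
    · exact (h.centre_adj_far hf hp hzw hz0 hz1 ⟨huy, fun hh => hy.1 hh.symm, hy.2⟩).symm
    · exact h.centre_adj_far hf hp hyw hy0 hy1 ⟨huz, fun hh => hz.1 hh.symm, hz.2⟩
    · exact h.centre_adj hf hp hyw hzw hy0 hy1 hz0 hz1 hyz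
  · rintro y ⟨huy, rfl | ⟨hyw, hy1⟩⟩ z ⟨huz, rfl | ⟨hzw, hz1⟩⟩ hyz
    · exact (hyz rfl).elim
    · exact hzw.symm
    · exact hyw
    · exact h.adj_of_not_adj_one hf hp huy huz hyw hzw hy1 hz1 hyz
  · rintro y ⟨huy, hyw, hy1, hy0⟩ z ⟨huz, hzw, hz1, hz0⟩ hyz
    exact h.adj_of_adj_one hf hp huy huz hyw hzw hy1 hy0 hz1 hz0 hyz
  · ext z
    simp only [SimpleGraph.mem_neighborSet, Set.mem_union, Set.mem_ofPred_eq]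
    tauto

end Balloon

end ForkParachute

/-- Main theorem: a (fork, odd parachute)-free graph that is not perfectly divisible
contains a trisimplicial vertex. -/
theorem stmt_6 {V : Type*} [Fintype V] (G : SimpleGraph V)
    (hfork : ForkFree G) (hpara : OddParachuteFree G)
    (h : ¬ PerfectlyDivisible G) :
    ∃ u : V, Trisimplicial G u := by
  obtain ⟨H, ⟨v, hv⟩, hH⟩ := ForkParachute.exists_minBad h
  obtain ⟨d, hd, -, u, hu, w, -, huw, hw, k, hk⟩ := hH.exists_hole hfork hv
  obtain ⟨j, hj⟩ := hd.attachment hfork hpara huw hw hk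
  have hb : ForkParachute.Balloon G (fun k => d (j + k)) u w :=
    ⟨hd.shift j, huw, fun k => hw _, fun k => by simpa using hj (j + k)⟩
  exact ⟨u, hb.trisimplicial hfork hpara hH hu⟩
end

section
/- Every claw-free graph that is not perfectly divisible contains a trisimplicial vertex. -/
open SimpleGraph

namespace SimpleGraph

variable {V : Type*} {G : SimpleGraph V}

/-- Any three distinct neighbors of a vertex of a claw-free graph span an edge. -/
lemma _root_.ClawFree.exists_adj (h : ClawFree G) {c x y z : V} (hx : G.Adj c x) (hy : G.Adj c y)
    (hz : G.Adj c z) (hxy : x ≠ y) (hxz : x ≠ z) (hyz : y ≠ z) :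
    G.Adj x y ∨ G.Adj x z ∨ G.Adj y z := by
  by_contra! hn
  obtain ⟨h1, h2, h3⟩ := hn
  have hcx := hx.ne
  have hcy := hy.ne
  have hcz := hz.ne
  have hinj : Function.Injective ![c, x, y, z] := by
    intro i j hij
    fin_cases i <;> fin_cases j <;> simp_all
  refine h.false ⟨⟨![c, x, y, z], hinj⟩, fun {i j} => ?_⟩
  change G.Adj (![c, x, y, z] i) (![c, x, y, z] j) ↔ _
  fin_cases i <;> fin_cases j <;> simp_all [claw, G.adj_comm]

/-- In a claw-free graph, two neighbors of `c` that miss a third neighbor of `c` are adjacent. -/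
lemma _root_.ClawFree.adj_of_not_adj (h : ClawFree G) {c x y z : V} (hx : G.Adj c x)
    (hy : G.Adj c y) (hz : G.Adj c z) (hxy : x ≠ y) (hxz : ¬ G.Adj x z) (hyz : ¬ G.Adj y z)
    (hxz' : x ≠ z) (hyz' : y ≠ z) : G.Adj x y := by
  rcases h.exists_adj hx hy hz hxy hxz' hyz' with h | h | h
  exacts [h, absurd h hxz, absurd h hyz]

/-- A proper coloring by natural numbers is a Grundy coloring if every vertex sees every color
smaller than its own. -/
def IsGrundyColoring (G : SimpleGraph V) (f : V → ℕ) : Prop :=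
  (∀ u v, G.Adj u v → f u ≠ f v) ∧ ∀ v, ∀ j < f v, ∃ u, G.Adj v u ∧ f u = j

lemma exists_isGrundyColoring [Finite V] (G : SimpleGraph V) :
    ∃ f : V → ℕ, IsGrundyColoring G f := by
  classical
  have := Fintype.ofFinite V
  let s : Set (V → ℕ) := {f | ∀ u v, G.Adj u v → f u ≠ f v}
  have hs : s.Nonempty := by
    obtain ⟨e⟩ := (Finite.exists_equiv_fin V).choose_spec
    refine ⟨fun v => e v, fun u v huv he => huv.ne (e.injective (Fin.ext he))⟩
  obtain ⟨f, hf, hmin⟩ := WellFounded.has_min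
    (InvImage.wf (fun f : V → ℕ => ∑ v, f v) Nat.lt_wfRel.wf) s hs
  refine ⟨f, hf, fun v j hj => ?_⟩
  by_contra! hn
  refine hmin (Function.update f v j) (fun a b hab => ?_) ?_
  · by_cases ha : a = v
    · subst ha
      simpa [Function.update_of_ne hab.ne'] using (hn b hab).symm
    · by_cases hb : b = v
      · subst hb
        simpa [Function.update_of_ne ha] using hn a hab.symm
      · simpa [Function.update_of_ne ha, Function.update_of_ne hb] using hf a b hab
  · refine Finset.sum_lt_sum (fun i _ => ?_) ⟨v, Finset.mem_univ v, by simpa using hj⟩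
    by_cases hi : i = v
    · subst hi
      simpa using hj.le
    · simp [Function.update_of_ne hi]

/-- A graph is `P₄`-free if it has no induced path on four vertices. -/
def IsP4Free (G : SimpleGraph V) : Prop :=
  ∀ ⦃p a b q⦄, G.Adj p a → G.Adj a b → G.Adj b q → ¬ G.Adj p b → ¬ G.Adj a q → G.Adj p q

/-- In a `P₄`-free graph with a Grundy coloring, a vertex of color at least `k` gives rise to a
clique of size `k + 1`. -/
lemma IsP4Free.exists_isNClique [Finite V] (hG : IsP4Free G) {f : V → ℕ}
    (hf : IsGrundyColoring G f) (v : V) (k : ℕ) (hk : k ≤ f v) :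
    ∃ s : Finset V, G.IsNClique (k + 1) s ∧ ∀ x ∈ s, f v - k ≤ f x := by
  classical
  have := Fintype.ofFinite V
  induction k with
  | zero => exact ⟨{v}, by simp [isNClique_iff], by simp⟩
  | succ k ih =>
    obtain ⟨s, hs, hsf⟩ := ih (by omega)
    set j := f v - (k + 1) with hj
    have hne : s.Nonempty := Finset.card_pos.mp (by rw [hs.card_eq]; omega)
    have hnbr : ∀ t ∈ s, ∃ u, G.Adj t u ∧ f u = j := fun t ht =>
      hf.2 t j (by have := hsf t ht; omega)
    obtain ⟨x, hx, hmax⟩ := Finset.exists_max_image (Finset.univ.filter fun x => f x = j)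
      (fun x => (s.filter (G.Adj x)).card) (by
        obtain ⟨t, ht⟩ := hne
        obtain ⟨u, -, hu⟩ := hnbr t ht
        exact ⟨u, by simpa using hu⟩)
    simp only [Finset.mem_filter, Finset.mem_univ, true_and] at hx hmax
    have hall : ∀ t ∈ s, G.Adj x t := by
      by_contra! hn
      obtain ⟨u, hu, hxu⟩ := hn
      obtain ⟨y, huy, hy⟩ := hnbr u hu
      obtain ⟨t, ht, hty⟩ : ∃ t ∈ s.filter (G.Adj x), t ∉ s.filter (G.Adj y) := by
        by_contra! hsub
        refine (hmax y hy).not_gt (Finset.card_lt_card ⟨hsub, fun h => hxu ?_⟩)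
        exact (Finset.mem_filter.mp (h (Finset.mem_filter.mpr ⟨hu, huy.symm⟩))).2
      obtain ⟨hts, hxt⟩ := Finset.mem_filter.mp ht
      have hyt : ¬ G.Adj y t := fun h => hty (Finset.mem_filter.mpr ⟨hts, h⟩)
      have htu : t ≠ u := by
        rintro rfl
        exact hxu hxt
      have hxy := hG hxt (hs.isClique hts hu htu) huy hxu fun h => hyt h.symm
      exact hf.1 x y hxy (hx.trans hy.symm)
    refine ⟨insert x s, hs.insert hall, fun y hy => ?_⟩
    rcases Finset.mem_insert.mp hy with rfl | hy
    · exact hx.ge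
    · exact le_trans (by omega) (hsf y hy)

lemma IsP4Free.chromaticNumber_eq [Finite V] (hG : IsP4Free G) :
    G.chromaticNumber = (cliqueNumber G : ℕ∞) := by
  have := Fintype.ofFinite V
  refine le_antisymm ?_ G.cliqueNum_le_chromaticNumber
  obtain ⟨f, hf⟩ := exists_isGrundyColoring G
  have hlt : ∀ v, f v < cliqueNumber G := fun v => by
    obtain ⟨s, hs, -⟩ := hG.exists_isNClique hf v (f v) le_rfl
    have := hs.isClique.card_le_cliqueNum
    rw [hs.card_eq] at this
    exact this
  refine Colorable.chromaticNumber_le ⟨Coloring.mk (fun v => ⟨f v, hlt v⟩) fun h he => ?_⟩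
  exact hf.1 _ _ h (by simpa using he)

lemma IsP4Free.induce (hG : IsP4Free G) (S : Set V) : IsP4Free (G.induce S) :=
  fun _ _ _ _ h1 h2 h3 h4 h5 => hG h1 h2 h3 h4 h5

/-- Cographs are perfect. -/
lemma IsP4Free.isPerfectGraph [Finite V] (hG : IsP4Free G) : IsPerfectGraph G :=
  fun S => (hG.induce S).chromaticNumber_eq

/-- In a claw-free graph without trisimplicial vertices, two vertices at distance two have a
nonadjacent pair of common neighbors. -/
lemma _root_.ClawFree.exists_common_neighbors (h : ClawFree G) (ht : ∀ u, ¬ Trisimplicial G u)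
    {a b u : V} (hab : a ≠ b) (hnab : ¬ G.Adj a b) (hau : G.Adj a u) (hbu : G.Adj b u) :
    ∃ y z, G.Adj a y ∧ G.Adj b y ∧ G.Adj a z ∧ G.Adj b z ∧ y ≠ z ∧ ¬ G.Adj y z := by
  by_contra! hn
  refine ht u ⟨{x | G.Adj u x ∧ ¬ G.Adj x a ∧ x ≠ a}, {x | G.Adj u x ∧ ¬ G.Adj x b ∧ x ≠ b},
    {x | G.Adj u x ∧ G.Adj a x ∧ G.Adj b x}, ?_, ?_, ?_, ?_⟩
  · rintro x ⟨hx, hxa, hxa'⟩ y ⟨hy, hya, hya'⟩ hxy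
    exact h.adj_of_not_adj hx hy hau.symm hxy hxa hya hxa' hya'
  · rintro x ⟨hx, hxa, hxa'⟩ y ⟨hy, hya, hya'⟩ hxy
    exact h.adj_of_not_adj hx hy hbu.symm hxy hxa hya hxa' hya'
  · rintro x ⟨-, hxa, hxb⟩ y ⟨-, hya, hyb⟩ hxy
    exact hn x y hxa hxb hya hyb hxy
  · ext x
    have h1 : x = a → ¬ G.Adj x b := by rintro rfl; exact hnab
    simp only [mem_neighborSet, Set.mem_union, Set.mem_ofPred_eq, G.adj_comm a x, G.adj_comm b x]
    have h2 : x = a → x ≠ b := by rintro rfl; exact hab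
    have h3 : x = b → ¬ G.Adj x a := by rintro rfl; exact fun h => hnab h.symm
    tauto

/-- In a claw-free graph without trisimplicial vertices, every component has diameter at most
two. -/
lemma _root_.ClawFree.exists_common_neighbor_of_reachable (h : ClawFree G)
    (ht : ∀ u, ¬ Trisimplicial G u) {w c : V} (hwc : G.Reachable w c) :
    w = c ∨ G.Adj w c ∨ ∃ u, G.Adj w u ∧ G.Adj c u := by
  rw [reachable_iff_reflTransGen] at hwc
  induction hwc with
  | refl => exact .inl rfl
  | @tail c d _ hcd ih =>
    rcases eq_or_ne w d with hwd | hwd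
    · exact .inl hwd
    rcases ih with rfl | hwc | ⟨u, hwu, hcu⟩
    · exact .inr (.inl hcd)
    · exact .inr (.inr ⟨c, hwc, hcd.symm⟩)
    by_cases hwc : G.Adj w c
    · exact .inr (.inr ⟨c, hwc, hcd.symm⟩)
    by_cases hwd' : G.Adj w d
    · exact .inr (.inl hwd')
    rcases eq_or_ne w c with rfl | hne
    · exact absurd hcd hwd'
    obtain ⟨y, z, hwy, hcy, hwz, hcz, hyz, hnyz⟩ := h.exists_common_neighbors ht hne hwc hwu hcu
    have hyd : y ≠ d := by rintro rfl; exact hwd' hwy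
    have hzd : z ≠ d := by rintro rfl; exact hwd' hwz
    rcases h.exists_adj hcy hcz hcd hyz hyd hzd with h1 | h1 | h1
    · exact absurd h1 hnyz
    · exact .inr (.inr ⟨y, hwy, h1.symm⟩)
    · exact .inr (.inr ⟨z, hwz, h1.symm⟩)

/-- Let `p a b q` be an induced path of a claw-free graph. If some vertex `w` without neighbors on
the path has a common neighbor with both `a` and `b`, then `a` is trisimplicial. -/
lemma _root_.ClawFree.trisimplicial_of_path (h : ClawFree G) {p a b q w y : V}
    (hpa : G.Adj p a) (hab : G.Adj a b) (hbq : G.Adj b q) (hpb : ¬ G.Adj p b) (haq : ¬ G.Adj a q)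
    (hpq : ¬ G.Adj p q) (hwp : ¬ G.Adj w p) (hwa : ¬ G.Adj w a) (hwb : ¬ G.Adj w b)
    (hwq : ¬ G.Adj w q) (hyw : G.Adj y w) (hya : G.Adj y a) (hyb : G.Adj y b) :
    Trisimplicial G a := by
  have npb : p ≠ b := by rintro rfl; exact hpq hbq
  have naq : a ≠ q := by rintro rfl; exact hpq hpa
  have npq : p ≠ q := by rintro rfl; exact hpb hbq.symm
  have nwp : w ≠ p := by rintro rfl; exact hwa hpa
  have nwa : w ≠ a := by rintro rfl; exact hwb hab
  have nwb : w ≠ b := by rintro rfl; exact hwa hab.symm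
  have nwq : w ≠ q := by rintro rfl; exact hwb hbq.symm
  have hnp : ∀ x, G.Adj x w → G.Adj x b → ¬ G.Adj x p := fun x hxw hxb hxp => by
    rcases h.exists_adj hxw hxb hxp nwb nwp npb.symm with h1 | h1 | h1
    exacts [hwb h1, hwp h1, hpb h1.symm]
  have hnq : ∀ x, G.Adj x w → G.Adj x a → ¬ G.Adj x q := fun x hxw hxa hxq => by
    rcases h.exists_adj hxw hxa hxq nwa nwq naq with h1 | h1 | h1
    exacts [hwa h1, hwq h1, haq h1]
  have hne : ∀ x z, G.Adj x w → ¬ G.Adj z w → x ≠ z := by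
    rintro x _ hx hz rfl
    exact hz hx
  have hcross : ∀ x m, G.Adj a x → G.Adj x w → G.Adj x b → G.Adj a m → G.Adj y m →
      ¬ G.Adj m w → G.Adj x m := by
    intro x m hax hxw hxb ham hym hmw
    rcases eq_or_ne m b with rfl | hmb
    · exact hxb
    by_contra hxm
    have nmw : m ≠ w := by rintro rfl; exact hwa ham.symm
    have hmb' : G.Adj m b :=
      h.adj_of_not_adj hym hyb hyw hmb hmw (fun h => hwb h.symm) nmw nwb.symm
    have nxm := hne x m hxw hmw
    have nmq : m ≠ q := by rintro rfl; exact haq ham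
    have nmp : m ≠ p := by rintro rfl; exact hpb hmb'
    have hmq : G.Adj m q := by
      rcases h.exists_adj hxb.symm hmb'.symm hbq nxm
        (hne x q hxw fun h => hwq h.symm) nmq with h1 | h1 | h1
      exacts [absurd h1 hxm, absurd h1 (hnq x hxw hax.symm), h1]
    have hmp : G.Adj m p := by
      rcases h.exists_adj hax ham hpa.symm nxm
        (hne x p hxw fun h => hwp h.symm) nmp with h1 | h1 | h1
      exacts [absurd h1 hxm, absurd h1 (hnp x hxw hxb), h1]
    rcases h.exists_adj hym.symm hmp hmq (hne y p hyw fun h => hwp h.symm)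
      (hne y q hyw fun h => hwq h.symm) npq with h1 | h1 | h1
    exacts [hnp y hyw hyb h1, hnq y hyw hya h1, hpq h1]
  refine ⟨{x | G.Adj a x ∧ (G.Adj x w ∧ G.Adj x b ∨ ¬ G.Adj x w ∧ G.Adj y x)},
    {x | G.Adj a x ∧ G.Adj x w ∧ ¬ G.Adj x b}, {x | G.Adj a x ∧ ¬ G.Adj x w ∧ ¬ G.Adj y x},
    ?_, ?_, ?_, ?_⟩
  · rintro x ⟨hx, ⟨hxw, hxb⟩ | ⟨hxw, hyx⟩⟩ z ⟨hz, ⟨hzw, hzb⟩ | ⟨hzw, hyz⟩⟩ hxz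
    · exact h.adj_of_not_adj hx hz hpa.symm hxz (hnp x hxw hxb) (hnp z hzw hzb)
        (hne x p hxw fun h => hwp h.symm) (hne z p hzw fun h => hwp h.symm)
    · exact hcross x z hx hxw hxb hz hyz hzw
    · exact (hcross z x hz hzw hzb hx hyx hxw).symm
    · exact h.adj_of_not_adj hyx hyz hyw hxz hxw hzw
        (by rintro rfl; exact hwa hx.symm) (by rintro rfl; exact hwa hz.symm)
  · rintro x ⟨hx, hxw, hxb⟩ z ⟨hz, hzw, hzb⟩ hxz
    exact h.adj_of_not_adj hx hz hab hxz hxb hzb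
      (hne x b hxw fun h => hwb h.symm) (hne z b hzw fun h => hwb h.symm)
  · rintro x ⟨hx, hxw, hyx⟩ z ⟨hz, hzw, hyz⟩ hxz
    exact h.adj_of_not_adj hx hz hya.symm hxz (fun h => hyx h.symm) (fun h => hyz h.symm)
      (hne y x hyw hxw).symm (hne y z hyw hzw).symm
  · ext x
    simp only [mem_neighborSet, Set.mem_union, Set.mem_ofPred_eq]
    tauto

/-- In a claw-free graph without trisimplicial vertices, no induced path on four vertices lies
in the non-neighborhood of a vertex of its component. -/
lemma _root_.ClawFree.adj_of_path_of_reachable (h : ClawFree G) (ht : ∀ u, ¬ Trisimplicial G u)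
    {p a b q w : V} (hw : G.Reachable w a)
    (hpa : G.Adj p a) (hab : G.Adj a b) (hbq : G.Adj b q) (hpb : ¬ G.Adj p b) (haq : ¬ G.Adj a q)
    (hwp : ¬ G.Adj w p) (hwa : ¬ G.Adj w a) (hwb : ¬ G.Adj w b) (hwq : ¬ G.Adj w q) :
    G.Adj p q := by
  by_contra hpq
  have nwa : w ≠ a := by rintro rfl; exact hwb hab
  rcases h.exists_common_neighbor_of_reachable ht hw with h1 | h1 | ⟨u, hwu, hau⟩
  · exact nwa h1
  · exact hwa h1
  obtain ⟨y, z, hwy, hay, hwz, haz, hyz, hnyz⟩ := h.exists_common_neighbors ht nwa hwa hwu hau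
  have hyb : y ≠ b := by rintro rfl; exact hwb hwy
  have hzb : z ≠ b := by rintro rfl; exact hwb hwz
  rcases h.exists_adj hay haz hab hyz hyb hzb with h1 | h1 | h1
  · exact hnyz h1
  · exact ht a (h.trisimplicial_of_path hpa hab hbq hpb haq hpq hwp hwa hwb hwq hwy.symm
      hay.symm h1)
  · exact ht a (h.trisimplicial_of_path hpa hab hbq hpb haq hpq hwp hwa hwb hwq hwz.symm
      haz.symm h1)

end SimpleGraph

/-- A claw-free graph without trisimplicial vertices is perfectly divisible. -/
theorem ClawFree.perfectlyDivisible {V : Type*} [Finite V] {G : SimpleGraph V} (h : ClawFree G)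
    (ht : ∀ u, ¬ Trisimplicial G u) : PerfectlyDivisible G := by
  classical
  intro S hS
  have hrep : ∀ K : G.ConnectedComponent, ∃ r : V, ∀ v ∈ S, G.connectedComponentMk v = K →
      r ∈ S ∧ G.connectedComponentMk r = K := fun K => by
    by_cases hK : ∃ v ∈ S, G.connectedComponentMk v = K
    · obtain ⟨v, hv, hvK⟩ := hK
      exact ⟨v, fun _ _ _ => ⟨hv, hvK⟩⟩
    · push Not at hK
      exact ⟨hS.some, fun v hv hvK => absurd hvK (hK v hv)⟩
  choose ρ hρ using hrep
  let r : V → V := fun v => ρ (G.connectedComponentMk v)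
  have hrS : ∀ v ∈ S, r v ∈ S := fun v hv => (hρ _ v hv rfl).1
  have hrr : ∀ v ∈ S, G.Reachable (r v) v := fun v hv =>
    ConnectedComponent.exact (hρ _ v hv rfl).2
  have hradj : ∀ {u v}, G.Adj u v → r u = r v := fun huv =>
    congrArg ρ (ConnectedComponent.sound huv.reachable)
  refine ⟨{v | v ∈ S ∧ ¬ G.Adj (r v) v}, {v | v ∈ S ∧ G.Adj (r v) v}, ?_, ?_, ?_, ?_⟩
  · ext v
    simp only [Set.mem_union, Set.mem_ofPred_eq]
    tauto
  · ext v
    simp only [Set.mem_inter_iff, Set.mem_ofPred_eq, Set.mem_empty_iff_false]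
    tauto
  · refine IsP4Free.isPerfectGraph ?_
    rintro ⟨p, _, hp⟩ ⟨a, haS, ha⟩ ⟨b, _, hb⟩ ⟨q, _, hq⟩ hpa hab hbq hpb haq
    change G.Adj p a at hpa
    change G.Adj a b at hab
    change G.Adj b q at hbq
    rw [hradj hpa] at hp
    rw [← hradj hbq, ← hradj hab] at hq
    rw [← hradj hab] at hb
    exact h.adj_of_path_of_reachable ht (hrr a haS) hpa hab hbq hpb haq hp ha hb hq
  · obtain ⟨s, hs⟩ := (G.induce {v | v ∈ S ∧ G.Adj (r v) v}).exists_isNClique_cliqueNum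
    suffices ∃ t : Finset S, (G.induce S).IsNClique (s.card + 1) t by
      obtain ⟨t, ht⟩ := this
      have hle := ht.isClique.card_le_cliqueNum
      rw [ht.card_eq, hs.card_eq] at hle
      exact hle
    let ι : {v | v ∈ S ∧ G.Adj (r v) v} ↪ S := ⟨fun v => ⟨v, v.2.1⟩, fun u v huv => by
      simpa [Subtype.ext_iff] using huv⟩
    have hclique : (G.induce S).IsNClique s.card (s.map ι) := by
      refine ⟨?_, Finset.card_map ι⟩
      rintro x hx y hy hxy
      obtain ⟨x, hxs, rfl⟩ := Finset.mem_map.mp hx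
      obtain ⟨y, hys, rfl⟩ := Finset.mem_map.mp hy
      exact hs.isClique hxs hys fun h => hxy (congrArg ι h)
    rcases s.eq_empty_or_nonempty with rfl | ⟨v, hv⟩
    · exact ⟨{⟨hS.some, hS.some_mem⟩}, by simp [isNClique_iff]⟩
    refine ⟨insert ⟨r v, hrS v v.2.1⟩ (s.map ι), hclique.insert fun x hx => ?_⟩
    obtain ⟨x, hxs, rfl⟩ := Finset.mem_map.mp hx
    have hrx : r x = r v := by
      rcases eq_or_ne x v with rfl | hxv
      · rfl
      · exact hradj (hs.isClique hxs hv hxv)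
    have hx2 := x.2.2
    rw [hrx] at hx2
    exact hx2

/-- Every claw-free graph that is not perfectly divisible contains a trisimplicial vertex. -/
theorem stmt_7 {V : Type*} [Fintype V] (G : SimpleGraph V)
    (hclaw : ClawFree G) (h : ¬ PerfectlyDivisible G) :
    ∃ u : V, Trisimplicial G u := by
  contrapose! h
  exact hclaw.perfectlyDivisible h
end
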